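/- arXiv:math/0111066 — 11 statements merged into one kernel-verified Lean document; each statement's English description precedes it below -/
import Mathlib

section
/- Let R be a simple ring and let P and Q be finitely generated projective right R-modules. If P is directly infinite, then there exists a nonzero right R-module A such that P is isomorphic to Q ⊕ A. -/
universe u v w

/-- Murray–von Neumann equivalence of idempotents: `e ∼ f` iff there are `x ∈ eRf`,
`y ∈ fRe` with `x*y = e` and `y*x = f`. -/
def IdemEquiv {R : Type*} [Ring R] (e f : R) : Prop :=
  ∃ x y : R, x = e * x * f ∧ y = f * y * e ∧ x * y = e ∧ y * x = f

/-- An idempotent `e` is infinite if `e = f + g` for orthogonal idempotents `f, g`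
with `g ≠ 0` and `e ∼ f`. -/
def IsInfiniteIdem {R : Type*} [Ring R] (e : R) : Prop :=
  IsIdempotentElem e ∧ ∃ f g : R, IsIdempotentElem f ∧ IsIdempotentElem g ∧
    f * g = 0 ∧ g * f = 0 ∧ e = f + g ∧ g ≠ 0 ∧ IdemEquiv e f

/-- A ring is purely infinite simple if it is simple and every nonzero right ideal
(submodule of `R` as a right module over itself, i.e. as an `Rᵐᵒᵖ`-module)
contains an infinite idempotent. -/
def PurelyInfiniteSimple (R : Type*) [Ring R] : Prop :=
  IsSimpleRing R ∧ ∀ I : Submodule Rᵐᵒᵖ R, I ≠ ⊥ → ∃ e ∈ I, IsInfiniteIdem e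

/-- A module `M` is directly infinite if `M ≅ M ⊕ B` for some nonzero module `B`. -/
def DirectlyInfinite (R : Type u) (M : Type v) [Ring R] [AddCommGroup M] [Module R M] : Prop :=
  ∃ (B : Type v) (_ : AddCommGroup B) (_ : Module R B),
    Nontrivial B ∧ Nonempty (M ≃ₗ[R] M × B)

theorem aux_sup {S : Type u} [Ring S] [IsSimpleRing S] (B Q : Type v) [AddCommGroup B] [Module S B]
    [AddCommGroup Q] [Module S Q] [Module.Projective S B] [Nontrivial B] :
    (⨆ f : B →ₗ[S] Q, LinearMap.range f) = ⊤ := by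
  set N : Submodule S Q := ⨆ f : B →ₗ[S] Q, LinearMap.range f with hN
  let I : TwoSidedIdeal S := TwoSidedIdeal.mk' {s | ∀ q : Q, s • q ∈ N}
    (by intro q; simp)
    (by intro x y hx hy q; rw [add_smul]; exact N.add_mem (hx q) (hy q))
    (by intro x hx q; rw [neg_smul]; exact N.neg_mem (hx q))
    (by intro x y hy q; rw [mul_smul]; exact N.smul_mem _ (hy q))
    (by intro x y hx q; rw [mul_smul]; exact hx _)
  obtain ⟨b, hb⟩ := exists_ne (0 : B)
  obtain ⟨s, hs⟩ := (Module.projective_def' (R := S) (P := B)).1 inferInstance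
  have hsb : s b ≠ 0 := by
    intro h
    apply hb
    have := LinearMap.congr_fun hs b
    simpa [h] using this.symm
  obtain ⟨c, hc⟩ := Finsupp.ne_iff.1 hsb
  have h1 : (1 : S) ∈ I := by
    refine IsSimpleRing.one_mem_of_ne_zero_mem I (x := s b c) hc ?_
    refine (TwoSidedIdeal.mem_mk' ..).2 ?_
    intro q
    refine (le_iSup (fun f : B →ₗ[S] Q => LinearMap.range f)
      ((LinearMap.toSpanSingleton S Q q).comp ((Finsupp.lapply c).comp s))) ?_
    exact ⟨b, by simp⟩
  have h2 := (TwoSidedIdeal.mem_mk' ..).1 h1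
  rw [eq_top_iff]
  intro q _
  simpa using h2 q

theorem aux_fin {S : Type u} [Ring S] (P B Q : Type v) [AddCommGroup B] [Module S B]
    [AddCommGroup Q] [Module S Q] [AddCommGroup P] [Module S P]
    (e : P ≃ₗ[S] P × B) (t : Finset (B →ₗ[S] Q)) :
    ∃ (X : Type v) (_ : AddCommGroup X) (_ : Module S X) (_ : P ≃ₗ[S] P × X) (g : X →ₗ[S] Q),
      (⨆ f ∈ t, LinearMap.range f) ≤ LinearMap.range g := by
  classical
  induction t using Finset.induction_on with
  | empty => exact ⟨B, inferInstance, inferInstance, e, 0, by simp⟩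
  | insert a t _ ih =>
    obtain ⟨X, i1, i2, e', g, hg⟩ := ih
    refine ⟨B × X, inferInstance, inferInstance,
      e'.trans ((e.prodCongr (LinearEquiv.refl S X)).trans (LinearEquiv.prodAssoc S P B X)),
      a.coprod g, ?_⟩
    rw [Finset.iSup_insert, LinearMap.range_coprod]
    exact sup_le_sup le_rfl hg

theorem aux_main {S : Type u} [Ring S] [IsSimpleRing S] (P Q : Type v)
    [AddCommGroup Q] [Module S Q] [AddCommGroup P] [Module S P]
    [Module.Projective S P] [Module.Finite S Q] [Module.Projective S Q]
    (hP : DirectlyInfinite S P) :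
    ∃ (A : Type v) (_ : AddCommGroup A) (_ : Module S A),
      Nontrivial A ∧ Nonempty (P ≃ₗ[S] Q × A) := by
  obtain ⟨B, _, _, hB, ⟨e⟩⟩ := hP
  have : Module.Projective S B := Module.Projective.of_split
    (e.symm.toLinearMap.comp (LinearMap.inr S P B)) ((LinearMap.snd S P B).comp e.toLinearMap)
    (by ext; simp)
  have : Nontrivial P := e.toEquiv.nontrivial
  have hc := (Submodule.fg_iff_compact (⊤ : Submodule S Q)).1 Module.Finite.fg_top
  obtain ⟨t, ht⟩ := CompleteLattice.IsCompactElement.exists_finset_of_le_iSup _ hc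
    (fun f : B →ₗ[S] Q => LinearMap.range f) (aux_sup B Q).ge
  obtain ⟨X, _, _, e', g, hg⟩ := aux_fin P B Q e t
  have hs : Function.Surjective g := LinearMap.range_eq_top.1 (top_le_iff.1 (ht.trans hg))
  obtain ⟨s, hs⟩ := Module.projective_lifting_property g LinearMap.id hs
  have hs' : ∀ q, g (s q) = q := fun q => LinearMap.congr_fun hs q
  have hk : ∀ x, (LinearMap.id - s.comp g : X →ₗ[S] X) x ∈ LinearMap.ker g := by intro x; simp [hs']
  let k : X ≃ₗ[S] Q × LinearMap.ker g := LinearEquiv.ofLinearMap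
    (g.prod ((LinearMap.id - s.comp g).codRestrict _ hk))
    (s.coprod (LinearMap.ker g).subtype)
    (by
      apply LinearMap.ext
      rintro ⟨q, x, hx⟩
      rw [LinearMap.mem_ker] at hx
      ext <;> simp [hs', hx])
    (by ext; simp)
  refine ⟨P × LinearMap.ker g, inferInstance, inferInstance, inferInstance, ⟨?_⟩⟩
  exact e'.trans (((LinearEquiv.refl S P).prodCongr k).trans
    ((LinearEquiv.prodAssoc S P Q _).symm.trans
      (((LinearEquiv.prodComm S P Q).prodCongr (LinearEquiv.refl S _)).trans
        (LinearEquiv.prodAssoc S Q P _))))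

/-- If `R` is a simple ring and `P`, `Q` are finitely generated
projective right `R`-modules with `P` directly infinite, then `P ≅ Q ⊕ A` for some
nonzero right `R`-module `A`. -/
theorem stmt0 {R : Type u} [Ring R] [IsSimpleRing R]
    (P Q : Type v) [AddCommGroup P] [Module Rᵐᵒᵖ P] [AddCommGroup Q] [Module Rᵐᵒᵖ Q]
    (hPfin : Module.Finite Rᵐᵒᵖ P) (hPproj : Module.Projective Rᵐᵒᵖ P)
    (hQfin : Module.Finite Rᵐᵒᵖ Q) (hQproj : Module.Projective Rᵐᵒᵖ Q)
    (hP : DirectlyInfinite Rᵐᵒᵖ P) :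
    ∃ (A : Type v) (_ : AddCommGroup A) (_ : Module Rᵐᵒᵖ A),
      Nontrivial A ∧ Nonempty (P ≃ₗ[Rᵐᵒᵖ] Q × A) := by
  exact aux_main P Q hP
end

section
/- Let R be a simple ring. Then R is purely infinite if and only if (a) R is not a division ring, and (b) for every nonzero element a ∈ R there exist elements x, y ∈ R such that x·a·y = 1. -/
universe u v w

lemma aux_infinite {R : Type u} [Ring R] {e x y g z : R}
    (hee : e * e = e) (hxe : x * e = x) (hxy : x * y = e) (hge : g * e = g) (heg : e * g = g)
    (hgg : g * g = g) (hxg : x * g = 0) (hgy : g * y = 0)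
    (h : ∃ A B : R, A * e * B = z) (s t : R) : ∃ A B : R, A * e * B = z + s * g * t := by
  obtain ⟨A, B, rfl⟩ := h
  refine ⟨A * x + s * g, y * B + g * t, ?_⟩
  have h1 : (A * x + s * g) * e = A * x + s * g := by
    rw [add_mul, mul_assoc A, hxe, mul_assoc s, hge]
  rw [h1]
  calc _ = A * (x * y) * B + A * (x * g) * t + s * (g * y) * B + s * (g * g) * t := by
        noncomm_ring
    _ = _ := by rw [hxy, hxg, hgy, hgg]; noncomm_ring

lemma aux_simple {R : Type u} [Ring R] [IsSimpleRing R] {g : R} (hg : g ≠ 0)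
    (P : R → Prop) (h0 : P 0) (h : ∀ z s t, P z → P (z + s * g * t)) : P 1 := by
  have h1 : (1 : R) ∈ TwoSidedIdeal.span {g} := by
    have : TwoSidedIdeal.span {g} = ⊤ := by
      rcases eq_bot_or_eq_top (TwoSidedIdeal.span {g}) with hb | ht
      · exfalso
        apply hg
        have : g ∈ TwoSidedIdeal.span {g} := TwoSidedIdeal.subset_span rfl
        rw [hb] at this
        exact (TwoSidedIdeal.mem_bot R).1 this
      · exact ht
    rw [this]; trivial
  rw [TwoSidedIdeal.mem_span_iff_mem_addSubgroup_closure] at h1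
  have key : ∀ z, P z → P (z + 1) ∧ P (z - 1) := by
    refine AddSubgroup.closure_induction
      (p := fun w _ => ∀ z, P z → P (z + w) ∧ P (z - w)) ?_ ?_ ?_ ?_ h1
    · rintro w hw z hz
      obtain ⟨s, t, rfl⟩ : ∃ s t, w = s * g * t := by
        simp only [Set.mem_mul, Set.mem_univ, Set.mem_singleton_iff, true_and] at hw
        obtain ⟨_, ⟨s, _, rfl, rfl⟩, t, rfl⟩ := hw
        exact ⟨s, t, rfl⟩
      refine ⟨h z s t hz, ?_⟩
      have := h z (-s) t hz
      rwa [neg_mul, neg_mul, ← sub_eq_add_neg] at this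
    · intro z hz; simpa using hz
    · intro a b _ _ ha hb z hz
      refine ⟨?_, ?_⟩
      · rw [← add_assoc]; exact (hb _ (ha z hz).1).1
      · rw [← sub_sub]; exact (hb _ (ha z hz).2).2
    · intro a _ ha z hz
      have := ha z hz
      rw [sub_neg_eq_add, ← sub_eq_add_neg]
      exact ⟨this.2, this.1⟩
  simpa using (key 0 h0).1

/-- A simple ring `R` is purely infinite iff it is not a division ring
and for every nonzero `a ∈ R` there are `x, y ∈ R` with `x * a * y = 1`. -/
theorem stmt2 {R : Type u} [Ring R] [IsSimpleRing R] :
    PurelyInfiniteSimple R ↔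
      (¬ ∀ a : R, a ≠ 0 → IsUnit a) ∧ (∀ a : R, a ≠ 0 → ∃ x y : R, x * a * y = 1) := by
  constructor
  · rintro ⟨_, H⟩
    refine ⟨?_, ?_⟩
    · intro hu
      obtain ⟨e, -, he, f, g, hf, hg, hfg, hgf, hefg, hg0, x, y, hx, hy, hxy, hyx⟩ :=
        H ⊤ top_ne_bot
      have hf0 : f = 0 := (hu g hg0).mul_left_eq_zero.1 hfg
      have he0 : e = 0 := by
        rw [← hxy, hx, hf0]; simp
      apply hg0
      rw [hf0, he0, zero_add] at hefg
      exact hefg.symm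
    · intro a ha
      have hne : Submodule.span Rᵐᵒᵖ {a} ≠ ⊥ := by
        simpa [Submodule.span_singleton_eq_bot] using ha
      obtain ⟨e, heI, he, f, g, hf, hg, hfg, hgf, hefg, hg0, x, y, hx, hy, hxy, hyx⟩ := H _ hne
      obtain ⟨r, hr⟩ := Submodule.mem_span_singleton.1 heI
      have hr' : a * r.unop = e := hr
      have hfe : f * e = f := by rw [hefg, mul_add, hf, hfg, add_zero]
      have hge : g * e = g := by rw [hefg, mul_add, hg, hgf, zero_add]
      have heg : e * g = g := by rw [hefg, add_mul, hg, hfg, zero_add]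
      have hxe : x * e = x := by rw [hx, mul_assoc, hfe]
      have hxg : x * g = 0 := by rw [hx, mul_assoc, hfg, mul_zero]
      have hgy : g * y = 0 := by rw [hy, ← mul_assoc, ← mul_assoc, hgf, zero_mul, zero_mul]
      obtain ⟨A, B, hAB⟩ := aux_simple hg0 (fun z => ∃ A B : R, A * e * B = z)
        ⟨0, 0, by simp⟩
        (fun z s t hz => aux_infinite he hxe hxy hge heg hg hxg hgy hz s t)
      refine ⟨A, r.unop * B, ?_⟩
      rw [← hAB, ← hr']; simp only [mul_assoc]
  · rintro ⟨hdiv, H⟩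
    refine ⟨inferInstance, fun I hI => ?_⟩
    obtain ⟨u, v, huv, hvu⟩ : ∃ u v : R, u * v = 1 ∧ v * u ≠ 1 := by
      by_contra hcon
      push Not at hcon
      apply hdiv
      intro b hb
      obtain ⟨x, y, hxy⟩ := H b hb
      have h1 := hcon x (b * y) (by rw [← mul_assoc, hxy])
      have h2 := hcon (x * b) y hxy
      refine ⟨⟨b, y * x, ?_, ?_⟩, rfl⟩
      · rw [← mul_assoc, h1]
      · rw [mul_assoc, h2]
    obtain ⟨a, haI, ha⟩ := I.ne_bot_iff.1 hI
    obtain ⟨q, w, hq⟩ := H a ha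
    obtain ⟨p, hp⟩ : ∃ p, p = a * w := ⟨_, rfl⟩
    have hqp : q * p = 1 := by rw [hp, ← mul_assoc, hq]
    have hqp' : ∀ z, q * (p * z) = z := fun z => by rw [← mul_assoc, hqp, one_mul]
    have huv' : ∀ z, u * (v * z) = z := fun z => by rw [← mul_assoc, huv, one_mul]
    refine ⟨p * q, ?_, ?_, p * (v * u) * q, p * (1 - v * u) * q, ?_, ?_, ?_, ?_, ?_, ?_,
      p * u * q, p * v * q, ?_, ?_, ?_, ?_⟩
    · have := I.smul_mem (MulOpposite.op (w * q)) haI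
      rw [hp, mul_assoc]
      exact this
    · simp only [IsIdempotentElem, mul_assoc, hqp']
    · simp only [IsIdempotentElem, mul_assoc, hqp', huv']
    · simp only [IsIdempotentElem, mul_assoc, hqp', huv', sub_mul, mul_sub, one_mul]
      simp
    · simp only [mul_assoc, hqp', huv', sub_mul, mul_sub, one_mul]
      simp
    · simp only [mul_assoc, hqp', huv', sub_mul, mul_sub, one_mul]
      simp
    · noncomm_ring
    · intro h0
      apply hvu
      have : q * (p * (1 - v * u) * q) * p = 1 - v * u := by
        simp only [mul_assoc, hqp', hqp, mul_one]
      rw [h0, mul_zero, zero_mul] at this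
      exact (sub_eq_zero.1 this.symm).symm
    all_goals simp only [mul_assoc, hqp', huv']
end

section
/- If R is a purely infinite simple ring and S is a ring Morita equivalent to R (the categories of R-modules and S-modules are equivalent), then S is a purely infinite simple ring. -/
universe u v w

open CategoryTheory in
theorem pis_of_context {C : Type*} [Category C] [Preadditive C] {Q B : C} {R S : Type*}
    [Ring R] [Ring S] (φ : R ≃+ (Q ⟶ Q)) (hφ : ∀ a b, φ (a * b) = φ a ≫ φ b)
    (hφ1 : φ 1 = 𝟙 Q) (ψ : S ≃+ (B ⟶ B)) (hψ : ∀ a b, ψ (a * b) = ψ a ≫ ψ b)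
    (hψ1 : ψ 1 = 𝟙 B) (hS : Nontrivial S)
    (hone : 𝟙 B ∈ AddSubgroup.closure {t : B ⟶ B | ∃ (y : B ⟶ Q) (x : Q ⟶ B), t = y ≫ x})
    (h : PurelyInfiniteSimple R) : PurelyInfiniteSimple S := by
  have key1 : ∀ {D : C} (s : B ⟶ D), (∀ x : Q ⟶ B, x ≫ s = 0) → s = 0 := by
    intro D s hs
    have : ∀ t ∈ AddSubgroup.closure {t : B ⟶ B | ∃ (y : B ⟶ Q) (x : Q ⟶ B), t = y ≫ x},
        t ≫ s = 0 := by
      intro t ht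
      induction ht using AddSubgroup.closure_induction with
      | mem t ht => obtain ⟨y, x, rfl⟩ := ht; simp [hs]
      | zero => simp
      | add a b _ _ ha hb => simp [ha, hb]
      | neg a _ ha => simp [ha]
    simpa using this _ hone
  have key2 : ∀ {D : C} (s : D ⟶ B), (∀ y : B ⟶ Q, s ≫ y = 0) → s = 0 := by
    intro D s hs
    have : ∀ t ∈ AddSubgroup.closure {t : B ⟶ B | ∃ (y : B ⟶ Q) (x : Q ⟶ B), t = y ≫ x},
        s ≫ t = 0 := by
      intro t ht
      induction ht using AddSubgroup.closure_induction with
      | mem t ht => obtain ⟨y, x, rfl⟩ := ht; simp [reassoc_of% (hs y)]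
      | zero => simp
      | add a b _ _ ha hb => simp [ha, hb]
      | neg a _ ha => simp [ha]
    simpa using this _ hone
  have key : ∀ s : S, s ≠ 0 → ∃ (x : Q ⟶ B) (y : B ⟶ Q), x ≫ ψ s ≫ y ≠ 0 := by
    intro s hs
    by_contra! hc
    apply hs
    have : ψ s = 0 := key1 _ fun x => key2 _ fun y => by simpa using hc x y
    simpa using this
  have hψs : ∀ a b, ψ.symm (a ≫ b) = ψ.symm a * ψ.symm b := by
    intro a b; apply ψ.injective; simp [hψ]
  have hφs : ∀ a b, φ.symm (a ≫ b) = φ.symm a * φ.symm b := by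
    intro a b; apply φ.injective; simp [hφ]
  obtain ⟨hR, hI⟩ := h
  refine ⟨⟨⟨fun I => ?_⟩⟩, fun I hI0 => ?_⟩
  · by_cases hb : I = ⊥
    · exact Or.inl hb
    right
    have : ∃ s ∈ I, s ≠ 0 := by
      by_contra! hc
      apply hb
      ext s
      rw [TwoSidedIdeal.mem_bot]
      exact ⟨hc s, fun hs => hs ▸ I.zero_mem⟩
    obtain ⟨s, hsI, hs0⟩ := this
    obtain ⟨x, y, hxy⟩ := key s hs0
    let K : TwoSidedIdeal R := TwoSidedIdeal.mk'
      {r | ∀ (y : B ⟶ Q) (x : Q ⟶ B), ψ.symm (y ≫ φ r ≫ x) ∈ I}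
      (by intro y x; simpa using I.zero_mem)
      (by intro a b ha hb y x; simpa using I.add_mem (ha y x) (hb y x))
      (by intro a ha y x; simpa using I.neg_mem (ha y x))
      (by intro a b hb y x; simpa [hφ] using hb (y ≫ φ a) x)
      (by intro a b ha y x; simpa [hφ] using ha y (φ b ≫ x))
    have hK : ∀ r, r ∈ K ↔ ∀ (y : B ⟶ Q) (x : Q ⟶ B), ψ.symm (y ≫ φ r ≫ x) ∈ I := by
      intro r; exact TwoSidedIdeal.mem_mk' _ _ _ _ _ _ _
    have hmem : φ.symm (x ≫ ψ s ≫ y) ∈ K := by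
      rw [hK]
      intro y' x'
      have : y' ≫ φ (φ.symm (x ≫ ψ s ≫ y)) ≫ x' = (y' ≫ x) ≫ ψ s ≫ (y ≫ x') := by simp
      rw [this, hψs, hψs, AddEquiv.symm_apply_apply]
      exact I.mul_mem_left _ _ (I.mul_mem_right _ _ hsI)
    have hKtop : K = ⊤ := by
      refine (eq_bot_or_eq_top K).resolve_left fun hK0 => hxy ?_
      rw [hK0, TwoSidedIdeal.mem_bot] at hmem
      simpa using hmem
    have h1 : ∀ (y : B ⟶ Q) (x : Q ⟶ B), ψ.symm (y ≫ x) ∈ I := by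
      have : (1 : R) ∈ K := hKtop ▸ trivial
      intro y x
      simpa [hφ1] using (hK 1).1 this y x
    have h2 : ∀ t ∈ AddSubgroup.closure {t : B ⟶ B | ∃ (y : B ⟶ Q) (x : Q ⟶ B), t = y ≫ x},
        ψ.symm t ∈ I := by
      intro t ht
      induction ht using AddSubgroup.closure_induction with
      | mem t ht => obtain ⟨y, x, rfl⟩ := ht; exact h1 y x
      | zero => simpa using I.zero_mem
      | add a b _ _ ha hb => simpa using I.add_mem ha hb
      | neg a _ ha => simpa using I.neg_mem ha
    have h3 := h2 _ hone
    rw [← hψ1, AddEquiv.symm_apply_apply] at h3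
    exact (TwoSidedIdeal.one_mem_iff I).1 h3
  · obtain ⟨s, hsI, hs0⟩ := Submodule.exists_mem_ne_zero_of_ne_bot hI0
    obtain ⟨x, y, hxy⟩ := key s hs0
    let J : Submodule Rᵐᵒᵖ R :=
      { carrier := {r | ∃ y : B ⟶ Q, φ r = x ≫ ψ s ≫ y}
        zero_mem' := ⟨0, by simp⟩
        add_mem' := by
          rintro a b ⟨y, hy⟩ ⟨z, hz⟩
          exact ⟨y + z, by simp [hy, hz]⟩
        smul_mem' := by
          rintro c a ⟨y, hy⟩
          exact ⟨y ≫ φ c.unop, by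
            rw [← MulOpposite.op_unop c, op_smul_eq_mul, hφ, hy]; simp⟩ }
    have hJ : J ≠ ⊥ := by
      intro h0
      have : φ.symm (x ≫ ψ s ≫ y) ∈ J := ⟨y, by simp⟩
      rw [h0, Submodule.mem_bot] at this
      exact hxy (by simpa using this)
    obtain ⟨e, ⟨y, hy⟩, he, f, g, hf, hg, hfg, hgf, hefg, hg0, p, q, hp, hq, hpq, hqp⟩ := hI J hJ
    have hvu : ∀ a b : R, (ψ s ≫ y ≫ φ e ≫ φ a ≫ φ e ≫ x) ≫ (ψ s ≫ y ≫ φ e ≫ φ b ≫ φ e ≫ x) =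
        ψ s ≫ y ≫ φ e ≫ φ (a * e * b) ≫ φ e ≫ x := by
      intro a b
      have h1 : φ e ≫ x ≫ ψ s ≫ y ≫ φ e = φ e := by
        have : x ≫ ψ s ≫ y ≫ φ e = φ e ≫ φ e := by rw [hy]; simp
        rw [this, ← hφ, ← hφ, he.eq, he.eq]
      have h2 := fun {Z : C} (k : Q ⟶ Z) => congrArg (· ≫ k) h1
      simp only [Category.assoc] at h2
      simp only [hφ, Category.assoc, h2]
    let T : R → S := fun a => ψ.symm (ψ s ≫ y ≫ φ e ≫ φ a ≫ φ e ≫ x)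
    have hTmul : ∀ a b, T a * T b = T (a * e * b) := by
      intro a b
      simp only [T]
      rw [← hψs, hvu]
    have hTadd : ∀ a b, T (a + b) = T a + T b := by intro a b; simp [T]
    have hT0 : T 0 = 0 := by simp [T]
    have hTe : ∀ a, T (e * a) = T a := by
      intro a
      simp only [T, hφ]
      rw [Category.assoc, ← Category.assoc (φ e) (φ e), ← hφ, he.eq]
    have hTinj : ∀ a, T a = 0 → e * a * e = 0 := by
      intro a ha
      have h0 : ψ s ≫ y ≫ φ e ≫ φ a ≫ φ e ≫ x = 0 := by simpa [T] using ha
      have h1 : (x ≫ ψ s ≫ y) ≫ φ e ≫ φ a ≫ φ e ≫ (x ≫ ψ s ≫ y) = 0 := by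
        have := congrArg (fun t => x ≫ t ≫ ψ s ≫ y) h0
        simpa using this
      rw [← hy, ← hφ, ← hφ, ← hφ, ← hφ, he.eq] at h1
      have h2 : e * (e * (a * e)) = 0 := by simpa using h1
      rwa [← mul_assoc, he.eq, ← mul_assoc] at h2
    have hef : e * f = f := by rw [hefg, add_mul, hf.eq, hgf, add_zero]
    have hfe : f * e = f := by rw [hefg, mul_add, hf.eq, hfg, add_zero]
    have heg : e * g = g := by rw [hefg, add_mul, hg.eq, hfg, zero_add]
    have hge : g * e = g := by rw [hefg, mul_add, hg.eq, hgf, zero_add]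
    have hpe : p * e = p := by
      rw [hp, mul_assoc, hfe]
    have hqe : q * e = q := by
      rw [hq, mul_assoc, he.eq]
    refine ⟨T e, ?_, ?_, T f, T g, ?_, ?_, ?_, ?_, ?_, ?_, T p, T q, ?_, ?_, ?_, ?_⟩
    · simp only [T]
      rw [hψs, AddEquiv.symm_apply_apply]
      have := I.smul_mem (MulOpposite.op (ψ.symm (y ≫ φ e ≫ φ e ≫ φ e ≫ x))) hsI
      rwa [op_smul_eq_mul] at this
    · rw [IsIdempotentElem, hTmul, he.eq, he.eq]
    · rw [IsIdempotentElem, hTmul, hfe, hf.eq]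
    · rw [IsIdempotentElem, hTmul, hge, hg.eq]
    · rw [hTmul, hfe, hfg, hT0]
    · rw [hTmul, hge, hgf, hT0]
    · rw [← hTadd, ← hefg]
    · intro h0
      have := hTinj g h0
      rw [heg, hge] at this
      exact hg0 this
    · rw [hTmul, hTmul, he.eq, mul_assoc e p e, hpe, ← hp]
    · rw [hTmul, hTmul, hfe, mul_assoc (f * q) e e, he.eq, ← hq]
    · rw [hTmul, hpe, hpq]
    · rw [hTmul, hqe, hqp]

/-- Right multiplications identify a ring with the endomorphisms of its left regular module. -/
noncomputable def regEnd (R : Type u) [Ring R] :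
    R ≃+ (ModuleCat.of R R ⟶ ModuleCat.of R R) where
  toFun r := ModuleCat.ofHom (LinearMap.toSpanSingleton R R r)
  invFun t := t.hom (1 : R)
  left_inv r := by simp
  right_inv t := by
    apply ModuleCat.hom_ext
    apply LinearMap.ext_ring
    simp
  map_add' a b := by
    apply ModuleCat.hom_ext
    apply LinearMap.ext_ring
    simp

open CategoryTheory in
theorem regEnd_mul (R : Type u) [Ring R] (a b : R) :
    regEnd R (a * b) = regEnd R a ≫ regEnd R b := by
  apply ModuleCat.hom_ext
  apply LinearMap.ext_ring
  simp [regEnd]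

open CategoryTheory in
theorem regEnd_one (R : Type u) [Ring R] : regEnd R 1 = 𝟙 _ := by
  apply ModuleCat.hom_ext
  apply LinearMap.ext_ring
  simp [regEnd]

open CategoryTheory in
theorem one_mem_trace {R S : Type u} [Ring R] [Ring S]
    (e : ModuleCat.{u} R ≌ ModuleCat.{u} S) :
    𝟙 (ModuleCat.of S S) ∈ AddSubgroup.closure
      {t : ModuleCat.of S S ⟶ ModuleCat.of S S |
        ∃ (y : ModuleCat.of S S ⟶ e.functor.obj (ModuleCat.of R R))
          (x : e.functor.obj (ModuleCat.of R R) ⟶ ModuleCat.of S S), t = y ≫ x} := by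
  set H := AddSubgroup.closure
      {t : ModuleCat.of S S ⟶ ModuleCat.of S S |
        ∃ (y : ModuleCat.of S S ⟶ e.functor.obj (ModuleCat.of R R))
          (x : e.functor.obj (ModuleCat.of R R) ⟶ ModuleCat.of S S), t = y ≫ x} with hH
  have hleft : ∀ (c : ModuleCat.of S S ⟶ ModuleCat.of S S), ∀ t ∈ H, c ≫ t ∈ H := by
    intro c t ht
    rw [hH] at ht
    induction ht using AddSubgroup.closure_induction with
    | mem t ht =>
      obtain ⟨y, x, rfl⟩ := ht
      exact AddSubgroup.subset_closure ⟨c ≫ y, x, by simp⟩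
    | zero => simpa using H.zero_mem
    | add a b _ _ ha hb => simpa using H.add_mem ha hb
    | neg a _ ha => simpa using H.neg_mem ha
  let J : Submodule S S :=
    { carrier := {s | regEnd S s ∈ H}
      zero_mem' := by simpa using H.zero_mem
      add_mem' := by intro a b ha hb; simpa using H.add_mem ha hb
      smul_mem' := by
        intro c a ha
        change regEnd S (c * a) ∈ H
        rw [regEnd_mul]
        exact hleft _ _ ha }
  have hJmem : ∀ s : S, s ∈ J ↔ regEnd S s ∈ H := fun s => Iff.rfl
  suffices h1 : (1 : S) ∈ J by
    rw [hJmem, regEnd_one] at h1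
    exact h1
  let m : ModuleCat.of S S ⟶ ModuleCat.of S (S ⧸ J) := ModuleCat.ofHom J.mkQ
  have hx : ∀ x : e.functor.obj (ModuleCat.of R R) ⟶ ModuleCat.of S S, x ≫ m = 0 := by
    intro x
    apply ModuleCat.hom_ext
    ext q
    have : x.hom q ∈ J := by
      rw [hJmem]
      refine AddSubgroup.subset_closure
        ⟨ModuleCat.ofHom (LinearMap.toSpanSingleton S _ q), x, ?_⟩
      apply ModuleCat.hom_ext
      apply LinearMap.ext_ring
      simp [regEnd]
    simpa [m] using this
  have hm : m = 0 := by
    have hz : ∀ {D : ModuleCat.{u} S} (a b : e.functor.obj (ModuleCat.of R R) ⟶ D), 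
        e.toAdjunction.homEquiv _ _ a = e.toAdjunction.homEquiv _ _ b → a = b :=
      fun a b hab => (e.toAdjunction.homEquiv _ _).injective hab
    apply e.inverse.map_injective
    apply ModuleCat.hom_ext
    ext p
    let z : ModuleCat.of R R ⟶ e.inverse.obj (ModuleCat.of S S) :=
      ModuleCat.ofHom (LinearMap.toSpanSingleton R _ p)
    have h1 := hx ((e.toAdjunction.homEquiv _ _).symm z)
    have h2 : z ≫ e.inverse.map m = z ≫ e.inverse.map 0 := by
      apply (e.toAdjunction.homEquiv _ _).symm.injective
      rw [Adjunction.homEquiv_naturality_right_symm, Adjunction.homEquiv_naturality_right_symm,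
        h1, Limits.comp_zero]
    have h3 := congrArg (fun t => t.hom (1 : R)) h2
    simpa [z] using h3
  have h4 : m.hom (1 : S) = 0 := by rw [hm]; rfl
  exact (Submodule.Quotient.mk_eq_zero J).1 h4


/-- Pure infinite simplicity is invariant under Morita equivalence:
if the module categories of `R` and `S` are equivalent (via an additive equivalence)
and `R` is purely infinite simple, then so is `S`. -/
theorem stmt3 {R S : Type u} [Ring R] [Ring S] (h : PurelyInfiniteSimple R)
    (e : ModuleCat.{u} R ≌ ModuleCat.{u} S) [e.functor.Additive] :
    PurelyInfiniteSimple S := by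
  have hR : Nontrivial R := by
    haveI := h.1
    infer_instance
  refine pis_of_context (Q := e.functor.obj (ModuleCat.of R R)) (B := ModuleCat.of S S)
    ((regEnd R).trans
      (AddEquiv.ofBijective (e.functor.mapAddHom (X := ModuleCat.of R R) (Y := ModuleCat.of R R))
        ⟨e.functor.map_injective, e.functor.map_surjective⟩))
    ?_ ?_ (regEnd S) (regEnd_mul S) (regEnd_one S) ?_ (one_mem_trace e) h
  · intro a b
    simp only [regEnd_mul, AddEquiv.trans_apply]
    exact e.functor.map_comp _ _
  · simp only [regEnd_one, AddEquiv.trans_apply]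
    exact e.functor.map_id _
  · by_contra hS
    rw [not_nontrivial_iff_subsingleton] at hS
    have h0 : regEnd R 1 = regEnd R 0 := by
      apply e.functor.map_injective
      apply ModuleCat.hom_ext
      ext q
      exact (Module.subsingleton S _).elim _ _
    exact one_ne_zero ((regEnd R).injective h0)
end

section
/- Let R be a von Neumann regular ring that is right self-injective (R is injective as a right module over itself) and has no nonzero directly finite central idempotents (i.e., for every nonzero central idempotent e ∈ R, the right R-module eR is directly infinite). Then for every maximal two-sided ideal M of R, the quotient ring R/M is a purely infinite simple ring. -/
universe u v w

namespace PIS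

/-- left multiplication as a map of right modules -/
def L {R : Type u} [Ring R] (a : R) : R →ₗ[Rᵐᵒᵖ] R where
  toFun r := a * r
  map_add' := mul_add a
  map_smul' := by
    intro m x
    simp [MulOpposite.smul_eq_mul_unop, mul_assoc]

@[simp] lemma L_apply {R : Type u} [Ring R] (a r : R) : L a r = a * r := rfl

lemma smul_mem' {R : Type u} [Ring R] (A : Submodule Rᵐᵒᵖ R) {a : R} (h : a ∈ A) (r : R) :
    a * r ∈ A := by
  have := A.smul_mem (MulOpposite.op r) h
  simpa using this

lemma exists_left {R : Type u} [Ring R] (hinj : Module.Injective Rᵐᵒᵖ R)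
    (G : Submodule Rᵐᵒᵖ (R × R)) (hG : ∀ u, ((0 : R), u) ∈ G → u = 0) :
    ∃ x : R, ∀ v u, (v, u) ∈ G → x * v = u := by
  obtain ⟨h, hh⟩ := hinj.out ((LinearMap.fst Rᵐᵒᵖ R R).comp G.subtype)
    (by
      rw [← LinearMap.ker_eq_bot, LinearMap.ker_eq_bot']
      rintro ⟨⟨v, u⟩, hm⟩ h0
      have : v = 0 := h0
      subst this
      have := hG u hm
      subst this
      rfl) ((LinearMap.snd Rᵐᵒᵖ R R).comp G.subtype)
  refine ⟨h 1, fun v u hvu => ?_⟩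
  have := hh ⟨(v, u), hvu⟩
  have h2 := h.map_smul (MulOpposite.op v) 1
  simp at h2 this
  rw [← h2, this]

lemma chain_mem {R : Type u} {N : Type v} [Ring R] [AddCommGroup N] [Module R N]
    {c : Set (Submodule R N)} (hc : IsChain (· ≤ ·) c) {y : Submodule R N} (hy : y ∈ c) {z : N} :
    z ∈ sSup c ↔ ∃ y ∈ c, z ∈ y :=
  Submodule.mem_sSup_of_directed ⟨y, hy⟩ hc.directedOn

lemma closure {R : Type u} [Ring R] (hreg : ∀ a : R, ∃ b : R, a * b * a = a)
    (hinj : Module.Injective Rᵐᵒᵖ R) (A : Submodule Rᵐᵒᵖ R) :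
    ∃ c : R, c * c = c ∧ (∀ a ∈ A, c * a = a) ∧ ∀ z : R, (∀ a ∈ A, z * a = 0) → z * c = 0 := by
  obtain ⟨D, -, hD⟩ := zorn_le_nonempty₀ {D : Submodule Rᵐᵒᵖ R | Disjoint A D}
    (by
      intro c hc hch y hy
      refine ⟨sSup c, ?_, fun z hz => le_sSup hz⟩
      simp only [Set.mem_ofPred_eq, Submodule.disjoint_def]
      intro x hxA hx
      obtain ⟨z, hz, hxz⟩ := (chain_mem hch hy).1 hx
      exact Submodule.disjoint_def.1 (hc hz) x hxA hxz) ⊥ (by simp)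
  have hdis : ∀ x ∈ A, x ∈ D → x = 0 := Submodule.disjoint_def.1 hD.1
  -- nonsingularity
  have key : ∀ z : R, (∀ a ∈ A, z * a = 0) → (∀ a ∈ D, z * a = 0) → z = 0 := by
    intro z hzA hzD
    obtain ⟨z', hz'⟩ := hreg z
    let X : Submodule Rᵐᵒᵖ R := D ⊔ LinearMap.range (L (z' * z))
    have hX : Disjoint A X := by
      rw [Submodule.disjoint_def]
      intro x hxA hxX
      obtain ⟨d, hd, w, ⟨r, rfl⟩, rfl⟩ := Submodule.mem_sup.1 hxX
      have h1 : z * (d + L (z' * z) r) = 0 := hzA _ hxA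
      have h2 : z * r = 0 := by
        rw [mul_add, hzD d hd, zero_add, L_apply, ← mul_assoc, ← mul_assoc, hz'] at h1
        exact h1
      have h3 : L (z' * z) r = 0 := by rw [L_apply, mul_assoc, h2, mul_zero]
      rw [h3, add_zero] at hxA ⊢
      exact hdis d hxA hd
    have hle : X ≤ D := hD.2 hX le_sup_left
    have : z' * z ∈ D := hle (Submodule.mem_sup_right ⟨1, by simp⟩)
    have := hzD _ this
    rwa [← mul_assoc, hz'] at this
  let G : Submodule Rᵐᵒᵖ (R × R) :=
    { carrier := {p | p.2 ∈ A ∧ p.1 - p.2 ∈ D}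
      add_mem' := by
        rintro ⟨a, b⟩ ⟨a', b'⟩ ⟨h1, h2⟩ ⟨h3, h4⟩
        refine ⟨A.add_mem h1 h3, ?_⟩
        have := D.add_mem h2 h4
        simpa [add_sub_add_comm] using this
      zero_mem' := by simp
      smul_mem' := by
        rintro r ⟨a, b⟩ ⟨h1, h2⟩
        refine ⟨A.smul_mem r h1, ?_⟩
        have := D.smul_mem r h2
        simpa [smul_sub, sub_mul] using this }
  obtain ⟨c, hc⟩ := exists_left hinj G (by
    rintro u ⟨h1, h2⟩
    apply hdis u h1
    simpa using h2)
  have hcA : ∀ a ∈ A, c * a = a := fun a ha => hc a a ⟨ha, by simp⟩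
  have hcD : ∀ a ∈ D, c * a = 0 := fun a ha => hc a 0 ⟨A.zero_mem, by simpa using ha⟩
  refine ⟨c, ?_, hcA, fun z hz => ?_⟩
  · rw [← sub_eq_zero]
    apply key
    · intro a ha; rw [sub_mul, mul_assoc, hcA a ha, hcA a ha, sub_self]
    · intro a ha; rw [sub_mul, mul_assoc, hcD a ha, mul_zero, sub_self]
  · apply key
    · intro a ha; rw [mul_assoc, hcA a ha, hz a ha]
    · intro a ha; rw [mul_assoc, hcD a ha, mul_zero]

lemma central {R : Type u} [Ring R] (hreg : ∀ a : R, ∃ b : R, a * b * a = a)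
    (hinj : Module.Injective Rᵐᵒᵖ R) (u v : R) (h : ∀ r, v * r * u = 0) :
    ∃ w : R, w * w = w ∧ (∀ x, w * x = x * w) ∧ w * u = u ∧ v * w = 0 := by
  let J : Submodule Rᵐᵒᵖ R :=
    { carrier := {z | ∀ r, v * r * z = 0}
      add_mem' := by
        intro a b ha hb r
        rw [mul_add, ha r, hb r, add_zero]
      zero_mem' := by simp
      smul_mem' := by
        intro r a ha s
        rw [MulOpposite.smul_eq_mul_unop, ← mul_assoc, ha s, zero_mul] }
  obtain ⟨c, hcc, hcJ, hz⟩ := closure hreg hinj J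
  have hc1 : ∀ r, v * r * c = 0 := fun r => hz _ (fun a ha => ha r)
  have hrc : ∀ r, c * (r * c) = r * c := fun r => hcJ _ (fun s => by
    rw [← mul_assoc, mul_assoc v]; exact hc1 _)
  refine ⟨c, hcc, fun r => ?_, hcJ u h, by simpa using hc1 1⟩
  have : c * r * (1 - c) = 0 := by
    obtain ⟨z', hz'⟩ := hreg (c * r * (1 - c))
    rw [← hz']
    have e1 : (1 - c) * (z' * c) = 0 := by rw [sub_mul, one_mul, hrc, sub_self]
    calc c * r * (1 - c) * z' * (c * r * (1 - c))
        = c * r * ((1 - c) * (z' * c)) * (r * (1 - c)) := by simp only [mul_assoc]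
      _ = 0 := by rw [e1]; simp
  rw [mul_sub, mul_one, sub_eq_zero] at this
  rw [this, mul_assoc, hrc]

lemma as {R : Type u} [Ring R] {a b c : R} (h : a * b = c) (z : R) : a * (b * z) = c * z := by
  rw [← mul_assoc, h]

lemma compIdem {R : Type u} [Ring R] (hreg : ∀ a : R, ∃ b : R, a * b * a = a)
    (hinj : Module.Injective Rᵐᵒᵖ R) (e f : R) (he : e * e = e) (hf : f * f = f) :
    ∃ w : R, w * w = w ∧ (∀ x, w * x = x * w) ∧ (∃ x y, w * e = x * f * y) ∧
      ∃ x y, (1 - w) * f = x * e * y := by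
  obtain ⟨G, -, hG⟩ := zorn_le_nonempty₀ {G : Submodule Rᵐᵒᵖ (R × R) |
      (∀ v u, (v, u) ∈ G → e * v = v ∧ f * u = u) ∧ (∀ u, ((0 : R), u) ∈ G → u = 0) ∧
      (∀ v, (v, (0 : R)) ∈ G → v = 0)}
    (by
      intro c hc hch y hy
      refine ⟨sSup c, ⟨?_, ?_, ?_⟩, fun z hz => le_sSup hz⟩
      · intro v u h
        obtain ⟨z, hz, hxz⟩ := (chain_mem hch hy).1 h
        exact (hc hz).1 v u hxz
      · intro u h
        obtain ⟨z, hz, hxz⟩ := (chain_mem hch hy).1 h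
        exact (hc hz).2.1 u hxz
      · intro u h
        obtain ⟨z, hz, hxz⟩ := (chain_mem hch hy).1 h
        exact (hc hz).2.2 u hxz) ⊥ (by
      refine ⟨?_, ?_, ?_⟩
      · intro v u h
        simp at h
        simp [h]
      · intro u h
        simpa using h
      · intro u h
        simpa using h)
  obtain ⟨⟨h1, h2, h3⟩, hmax⟩ := hG
  obtain ⟨x, hx⟩ := exists_left hinj G h2
  obtain ⟨y, hy⟩ := exists_left hinj (G.map (LinearMap.prod (LinearMap.snd Rᵐᵒᵖ R R)
      (LinearMap.fst Rᵐᵒᵖ R R))) (by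
    rintro u ⟨⟨a, b⟩, hab, heq⟩
    simp at heq
    obtain ⟨rfl, rfl⟩ := heq
    exact h3 _ hab)
  have hy' : ∀ v u, (v, u) ∈ G → y * u = v := fun v u h => hy u v ⟨(v, u), h, rfl⟩
  obtain ⟨g0, hg0, hgA, hgz⟩ := closure hreg hinj (G.map (LinearMap.fst Rᵐᵒᵖ R R))
  have hgz' : ∀ z, (∀ v u, (v, u) ∈ G → z * v = 0) → z * g0 = 0 := by
    intro z hz
    apply hgz
    rintro _ ⟨⟨a, b⟩, hab, rfl⟩
    exact hz a b hab
  have eg0 : e * g0 = g0 := by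
    have := hgz' (e - 1) (fun v u h => by rw [sub_mul, (h1 v u h).1, one_mul, sub_self])
    rwa [sub_mul, one_mul, sub_eq_zero] at this
  have yxg0 : y * x * g0 = g0 := by
    have := hgz' (y * x - 1) (fun v u h => by
      rw [sub_mul, mul_assoc, hx v u h, hy' v u h, one_mul, sub_self])
    rwa [sub_mul, one_mul, sub_eq_zero] at this
  have fxg0 : f * x * g0 = x * g0 := by
    have := hgz' (f * x - x) (fun v u h => by
      rw [sub_mul, mul_assoc, hx v u h, (h1 v u h).2, sub_self])
    rwa [sub_mul, sub_eq_zero] at this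
  obtain ⟨g, hg⟩ : ∃ g, g = g0 * e := ⟨_, rfl⟩
  have hgg : g * g = g := by subst hg; simp only [mul_assoc, as eg0, as hg0]
  have hge : g * e = g := by subst hg; simp only [mul_assoc, he]
  have heg : e * g = g := by subst hg; simp only [as eg0]
  have yxg : y * (x * g) = g := by subst hg; simp only [← mul_assoc, yxg0]
  have fxg : f * (x * g) = x * g := by subst hg; simp only [← mul_assoc, fxg0]
  have gA : ∀ v u, (v, u) ∈ G → g * v = v := by
    intro v u h
    rw [hg, mul_assoc, (h1 v u h).1]
    exact hgA v ⟨(v, u), h, rfl⟩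
  obtain ⟨p, hp⟩ : ∃ p, p = x * g := ⟨_, rfl⟩
  obtain ⟨q, hq⟩ : ∃ q, q = g * y * f := ⟨_, rfl⟩
  have fp : f * p = p := by rw [hp, fxg]
  have qp : q * p = g := by rw [hq, mul_assoc, fp, hp, mul_assoc, yxg, hgg]
  have pg : p * g = p := by rw [hp, mul_assoc, hgg]
  have pe : p * e = p := by rw [hp, mul_assoc, hge]
  have gq : g * q = q := by rw [hq]; simp only [← mul_assoc, hgg]
  have qf : q * f = q := by rw [hq]; simp only [mul_assoc, hf]
  have main : ∀ r, (f - p * q) * r * (e - g) = 0 := by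
    intro r
    obtain ⟨z, hz⟩ : ∃ z, z = (f - p * q) * r * (e - g) := ⟨_, rfl⟩
    rw [← hz]
    obtain ⟨z', hz'⟩ := hreg z
    obtain ⟨t, ht⟩ : ∃ t, t = (e - g) * z' := ⟨_, rfl⟩
    have zg : z * g = 0 := by
      rw [hz, mul_assoc, sub_mul e g, heg, hgg, sub_self, mul_zero]
    have ze : z * e = z := by
      rw [hz, mul_assoc, sub_mul e g, he, hge]
    have ztz : z * t * z = z := by
      rw [ht, ← mul_assoc, mul_sub, ze, zg, sub_zero, hz']
    have qz : q * z = 0 := by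
      have : q * (f - p * q) = 0 := by rw [mul_sub, qf, ← mul_assoc, qp, gq, sub_self]
      rw [hz]; simp only [← mul_assoc, this, zero_mul]
    have fz : f * z = z := by
      have : f * (f - p * q) = f - p * q := by rw [mul_sub, hf, ← mul_assoc, fp]
      rw [hz]; simp only [← mul_assoc, this]
    have fpqp : (f - p * q) * p = 0 := by rw [sub_mul, fp, mul_assoc, qp, pg, sub_self]
    have fpqz : (f - p * q) * z = z := by rw [sub_mul, fz, mul_assoc, qz, mul_zero, sub_zero]
    have pt : p * t = 0 := by rw [ht, ← mul_assoc, mul_sub, pe, pg, sub_self, zero_mul]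
    have gt : g * t = 0 := by rw [ht, ← mul_assoc, mul_sub, hge, hgg, sub_self, zero_mul]
    have et : e * t = t := by rw [ht, ← mul_assoc, mul_sub, he, heg]
    have Pg : (p + z) * (g + t * z) = p + z := by
      have : z * (t * z) = z := by rw [← mul_assoc, ztz]
      rw [add_mul, mul_add, mul_add, pg, zg, as pt, this]; simp
    have QP : (q + t * (f - p * q)) * (p + z) = g + t * z := by
      rw [add_mul, mul_add, mul_add, mul_assoc, mul_assoc, qp, qz, fpqp, fpqz]; simp
    let G' : Submodule Rᵐᵒᵖ (R × R) := LinearMap.range ((L (g + t * z)).prod (L (p + z)))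
    have hle : G ≤ G' := by
      rintro ⟨v, u⟩ h
      have zv : z * v = 0 := by rw [← gA v u h, as zg, zero_mul]
      refine ⟨v, ?_⟩
      simp only [LinearMap.prod_apply, L_apply, Function.prod_apply, add_mul, mul_assoc, zv,
        gA v u h, mul_zero, add_zero, hp, hx v u h]
    have hG' : G' ≤ G := by
      apply hmax _ hle
      refine ⟨?_, ?_, ?_⟩
      · rintro v u ⟨s, hs⟩
        simp at hs
        obtain ⟨rfl, rfl⟩ := hs
        constructor
        · rw [← mul_assoc, mul_add, heg, as et]
        · rw [← mul_assoc, mul_add, fp, fz]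
      · rintro u ⟨s, hs⟩
        simp at hs
        obtain ⟨h5, rfl⟩ := hs
        rw [← Pg, mul_assoc, h5, mul_zero]
      · rintro v ⟨s, hs⟩
        simp at hs
        obtain ⟨rfl, h5⟩ := hs
        rw [← QP, mul_assoc, h5, mul_zero]
    have hin : (g + t * z, p + z) ∈ G := hG' ⟨1, by simp⟩
    have := gA _ _ hin
    rw [mul_add, hgg, as gt, zero_mul, add_zero] at this
    have tz : t * z = 0 := by simpa using this
    rw [← ztz, mul_assoc, tz, mul_zero]
  obtain ⟨w, hw, hwc, hwu, hwv⟩ := central hreg hinj (e - g) (f - p * q) main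
  refine ⟨1 - w, ?_, ?_, ⟨(1 - w) * q, p, ?_⟩, ⟨w * p, q, ?_⟩⟩
  · rw [mul_sub, sub_mul, sub_mul, hw]; simp
  · intro x; rw [sub_mul, mul_sub, hwc]; simp
  · rw [mul_assoc, mul_assoc, fp, qp]
    have : (1 - w) * (e - g) = 0 := by rw [sub_mul, hwu]; simp
    rwa [mul_sub, sub_eq_zero] at this
  · rw [sub_sub_cancel, mul_assoc, mul_assoc, as pe]
    rw [← hwc, mul_sub, sub_eq_zero] at hwv
    exact hwv

lemma comp {R : Type u} [Ring R] (hreg : ∀ a : R, ∃ b : R, a * b * a = a)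
    (hinj : Module.Injective Rᵐᵒᵖ R) (a b : R) :
    ∃ w : R, w * w = w ∧ (∀ x, w * x = x * w) ∧ (∃ x y, w * a = x * b * y) ∧
      ∃ x y, (1 - w) * b = x * a * y := by
  obtain ⟨a', ha⟩ := hreg a
  obtain ⟨b', hb⟩ := hreg b
  obtain ⟨w, hw, hwc, ⟨x, y, h1⟩, ⟨x', y', h2⟩⟩ := compIdem hreg hinj (a * a') (b * b')
    (by rw [← mul_assoc, ha]) (by rw [← mul_assoc, hb])
  refine ⟨w, hw, hwc, ⟨x, b' * y * a, ?_⟩, ⟨x', a' * y' * b, ?_⟩⟩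
  · calc w * a = w * (a * a') * a := by rw [mul_assoc, ha]
      _ = _ := by rw [h1]; simp only [mul_assoc]
  · calc (1 - w) * b = (1 - w) * (b * b') * b := by rw [mul_assoc, hb]
      _ = _ := by rw [h2]; simp only [mul_assoc]

structure PI {R : Type u} [Ring R] (c s1 s2 t1 t2 : R) : Prop where
  cc : c * c = c
  cs1 : c * s1 = s1
  s1c : s1 * c = s1
  cs2 : c * s2 = s2
  s2c : s2 * c = s2
  ct1 : c * t1 = t1
  t1c : t1 * c = t1
  ct2 : c * t2 = t2
  t2c : t2 * c = t2
  t1s1 : t1 * s1 = c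
  t1s2 : t1 * s2 = 0
  t2s1 : t2 * s1 = 0
  t2s2 : t2 * s2 = c

structure Valid {R : Type u} [Ring R] (G : Submodule Rᵐᵒᵖ (R × R × R)) : Prop where
  v1 : ∀ a b b', (a, b, b') ∈ G → (∃ x y, (b, x, y) ∈ G) ∧ ∃ x y, (b', x, y) ∈ G
  v2 : ∀ b b', ((0 : R), b, b') ∈ G → b = 0 ∧ b' = 0
  v3 : ∀ a1 b1 c1 a2 b2 c2, (a1, b1, c1) ∈ G → (a2, b2, c2) ∈ G → b1 + c2 = 0 → a1 = 0 ∧ a2 = 0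

lemma valid_of_pi {R : Type u} [Ring R] {c s1 s2 t1 t2 : R} (h : PI c s1 s2 t1 t2) :
    Valid (LinearMap.range ((L c).prod ((L s1).prod (L s2)))) := by
  refine ⟨?_, ?_, ?_⟩
  · rintro a b b' ⟨r, hr⟩
    simp at hr
    obtain ⟨rfl, rfl, rfl⟩ := hr
    refine ⟨⟨s1 * (s1 * r), s2 * (s1 * r), s1 * r, ?_⟩, ⟨s1 * (s2 * r), s2 * (s2 * r), s2 * r, ?_⟩⟩
    · simp [as h.cs1]
    · simp [as h.cs2]
  · rintro b b' ⟨r, hr⟩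
    simp at hr
    obtain ⟨h0, rfl, rfl⟩ := hr
    constructor
    · rw [← h.s1c, mul_assoc, h0, mul_zero]
    · rw [← h.s2c, mul_assoc, h0, mul_zero]
  · rintro a1 b1 c1 a2 b2 c2 ⟨r, hr⟩ ⟨r', hr'⟩ h0
    simp at hr hr'
    obtain ⟨rfl, rfl, rfl⟩ := hr
    obtain ⟨rfl, rfl, rfl⟩ := hr'
    constructor
    · have := congrArg (t1 * ·) h0
      simpa [mul_add, as h.t1s1, as h.t1s2] using this
    · have := congrArg (t2 * ·) h0
      simpa [mul_add, as h.t2s1, as h.t2s2] using this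

lemma pi_of_valid {R : Type u} [Ring R] (hreg : ∀ a : R, ∃ b : R, a * b * a = a)
    (hinj : Module.Injective Rᵐᵒᵖ R) (G : Submodule Rᵐᵒᵖ (R × R × R)) (hG : Valid G) :
    ∃ c s1 s2 t1 t2 : R, PI c s1 s2 t1 t2 ∧
      ∀ a b b', (a, b, b') ∈ G → c * a = a ∧ s1 * a = b ∧ s2 * a = b' := by
  let f1 := LinearMap.fst Rᵐᵒᵖ R (R × R)
  let f2 := (LinearMap.fst Rᵐᵒᵖ R R).comp (LinearMap.snd Rᵐᵒᵖ R (R × R))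
  let f3 := (LinearMap.snd Rᵐᵒᵖ R R).comp (LinearMap.snd Rᵐᵒᵖ R (R × R))
  obtain ⟨s1, hs1⟩ := exists_left hinj (G.map (f1.prod f2)) (by
    rintro u ⟨⟨a, b, b'⟩, h, heq⟩
    simp [f1, f2] at heq
    obtain ⟨rfl, rfl⟩ := heq
    exact (hG.v2 _ _ h).1)
  obtain ⟨s2, hs2⟩ := exists_left hinj (G.map (f1.prod f3)) (by
    rintro u ⟨⟨a, b, b'⟩, h, heq⟩
    simp [f1, f3] at heq
    obtain ⟨rfl, rfl⟩ := heq
    exact (hG.v2 _ _ h).2)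
  have hs1' : ∀ a b b', (a, b, b') ∈ G → s1 * a = b := fun a b b' h => hs1 a b ⟨_, h, rfl⟩
  have hs2' : ∀ a b b', (a, b, b') ∈ G → s2 * a = b' := fun a b b' h => hs2 a b' ⟨_, h, rfl⟩
  let F1 := LinearMap.fst Rᵐᵒᵖ (R × R × R) (R × R × R)
  let F2 := LinearMap.snd Rᵐᵒᵖ (R × R × R) (R × R × R)
  obtain ⟨t1, ht1⟩ := exists_left hinj
    ((G.prod G).map ((f2.comp F1 + f3.comp F2).prod (f1.comp F1))) (by
    rintro u ⟨⟨⟨a, b, b'⟩, ⟨x, y, y'⟩⟩, ⟨h, h'⟩, heq⟩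
    simp [f1, f2, f3, F1, F2] at heq
    obtain ⟨h0, rfl⟩ := heq
    exact (hG.v3 _ _ _ _ _ _ h h' h0).1)
  obtain ⟨t2, ht2⟩ := exists_left hinj
    ((G.prod G).map ((f2.comp F1 + f3.comp F2).prod (f1.comp F2))) (by
    rintro u ⟨⟨⟨a, b, b'⟩, ⟨x, y, y'⟩⟩, ⟨h, h'⟩, heq⟩
    simp [f1, f2, f3, F1, F2] at heq
    obtain ⟨h0, rfl⟩ := heq
    exact (hG.v3 _ _ _ _ _ _ h h' h0).2)
  have ht1' : ∀ a b b' x y y', (a, b, b') ∈ G → (x, y, y') ∈ G → t1 * (b + y') = a :=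
    fun a b b' x y y' h h' => ht1 _ _ ⟨((a, b, b'), (x, y, y')), ⟨h, h'⟩, rfl⟩
  have ht2' : ∀ a b b' x y y', (a, b, b') ∈ G → (x, y, y') ∈ G → t2 * (b + y') = x :=
    fun a b b' x y y' h h' => ht2 _ _ ⟨((a, b, b'), (x, y, y')), ⟨h, h'⟩, rfl⟩
  obtain ⟨c, hc, hcA, hz⟩ := closure hreg hinj (G.map f1)
  have hcA' : ∀ a b b', (a, b, b') ∈ G → c * a = a := fun a b b' h => hcA a ⟨_, h, rfl⟩
  have hz' : ∀ z, (∀ a b b', (a, b, b') ∈ G → z * a = 0) → z * c = 0 := by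
    intro z h
    apply hz
    rintro _ ⟨⟨a, b, b'⟩, hab, rfl⟩
    exact h a b b' hab
  have h00 : ((0 : R), (0 : R), (0 : R)) ∈ G := G.zero_mem
  have e11 : t1 * (s1 * c) = c := by
    have := hz' (t1 * s1 - 1) (fun a b b' h => by
      have := ht1' _ _ _ _ _ _ h h00
      rw [add_zero] at this
      rw [sub_mul, mul_assoc, hs1' _ _ _ h, this]; simp)
    rwa [sub_mul, one_mul, sub_eq_zero, mul_assoc] at this
  have e12 : t1 * (s2 * c) = 0 := by
    have := hz' (t1 * s2) (fun a b b' h => by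
      have := ht1' _ _ _ _ _ _ h00 h
      rw [zero_add] at this
      rw [mul_assoc, hs2' _ _ _ h, this])
    rwa [mul_assoc] at this
  have e21 : t2 * (s1 * c) = 0 := by
    have := hz' (t2 * s1) (fun a b b' h => by
      have := ht2' _ _ _ _ _ _ h h00
      rw [add_zero] at this
      rw [mul_assoc, hs1' _ _ _ h, this])
    rwa [mul_assoc] at this
  have e22 : t2 * (s2 * c) = c := by
    have := hz' (t2 * s2 - 1) (fun a b b' h => by
      have := ht2' _ _ _ _ _ _ h00 h
      rw [zero_add] at this
      rw [sub_mul, mul_assoc, hs2' _ _ _ h, this]; simp)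
    rwa [sub_mul, one_mul, sub_eq_zero, mul_assoc] at this
  have d1 : c * (s1 * c) = s1 * c := by
    have := hz' (c * s1 - s1) (fun a b b' h => by
      obtain ⟨⟨x, y, hxy⟩, -⟩ := hG.v1 _ _ _ h
      rw [sub_mul, mul_assoc, hs1' _ _ _ h, hcA' _ _ _ hxy, sub_self])
    rwa [sub_mul, sub_eq_zero, mul_assoc] at this
  have d2 : c * (s2 * c) = s2 * c := by
    have := hz' (c * s2 - s2) (fun a b b' h => by
      obtain ⟨-, ⟨x, y, hxy⟩⟩ := hG.v1 _ _ _ h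
      rw [sub_mul, mul_assoc, hs2' _ _ _ h, hcA' _ _ _ hxy, sub_self])
    rwa [sub_mul, sub_eq_zero, mul_assoc] at this
  refine ⟨c, s1 * c, s2 * c, c * t1 * c, c * t2 * c, ?_, ?_⟩
  · constructor <;> simp only [mul_assoc, hc, as hc, d1, d2, e11, e12, e21, e22, mul_zero]
  · intro a b b' h
    have := hcA' _ _ _ h
    refine ⟨this, ?_, ?_⟩
    · rw [mul_assoc, this, hs1' _ _ _ h]
    · rw [mul_assoc, this, hs2' _ _ _ h]

lemma pi_add {R : Type u} [Ring R] {c s1 s2 t1 t2 d x1 x2 y1 y2 : R}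
    (h : PI c s1 s2 t1 t2) (h' : PI d x1 x2 y1 y2) (cd : c * d = 0) (dc : d * c = 0) :
    PI (c + d) (s1 + x1) (s2 + x2) (t1 + y1) (t2 + y2) := by
  have aux : ∀ {p q : R}, p * c = p → d * q = q → p * q = 0 := by
    intro p q hp hq
    rw [← hp, ← hq, mul_assoc, as cd, zero_mul, mul_zero]
  have aux' : ∀ {p q : R}, p * d = p → c * q = q → p * q = 0 := by
    intro p q hp hq
    rw [← hp, ← hq, mul_assoc, as dc, zero_mul, mul_zero]
  obtain ⟨a1, a2, a3, a4, a5, a6, a7, a8, a9, a10, a11, a12, a13⟩ := h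
  obtain ⟨b1, b2, b3, b4, b5, b6, b7, b8, b9, b10, b11, b12, b13⟩ := h'
  constructor <;> rw [add_mul, mul_add, mul_add] <;>
    simp only [cd, dc, a1, a2, a3, a4, a5, a6, a7, a8, a9, a10, a11, a12, a13, b1, b2, b3, b4, b5,
      b6, b7, b8, b9, b10, b11, b12, b13, aux, aux', add_zero, zero_add]

lemma pi_central {R : Type u} [Ring R] {c s1 s2 t1 t2 : R} (w : R) (hw : w * w = w)
    (hwc : ∀ x, w * x = x * w)
    (h : PI c s1 s2 t1 t2) : PI (w * c) (w * s1) (w * s2) (w * t1) (w * t2) := by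
  have aux : ∀ p q : R, w * p * (w * q) = w * (p * q) := by
    intro p q
    rw [mul_assoc, ← mul_assoc p, ← hwc p, mul_assoc, ← mul_assoc, hw]
  obtain ⟨a1, a2, a3, a4, a5, a6, a7, a8, a9, a10, a11, a12, a13⟩ := h
  clear hwc
  constructor <;> simp only [*, mul_zero]

lemma pi_transport {R : Type u} [Ring R] {c s1 s2 t1 t2 u v : R}
    (h : PI c s1 s2 t1 t2) (vu : v * u = c) :
    PI (u * c * v) (u * s1 * v) (u * s2 * v) (u * t1 * v) (u * t2 * v) := by
  obtain ⟨a1, a2, a3, a4, a5, a6, a7, a8, a9, a10, a11, a12, a13⟩ := h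
  constructor <;> simp only [mul_assoc, as vu, as a1, as a2, as a3, as a4, as a5, as a6, as a7,
    as a8, as a9, as a10, as a11, as a12, as a13, zero_mul, mul_zero]

lemma exists_max {R : Type u} [Ring R] (hreg : ∀ a : R, ∃ b : R, a * b * a = a)
    (hinj : Module.Injective Rᵐᵒᵖ R) :
    ∃ c s1 s2 t1 t2 : R, PI c s1 s2 t1 t2 ∧
      ∀ d x1 x2 y1 y2 : R, PI d x1 x2 y1 y2 → c * d = 0 → d * c = 0 → d = 0 := by
  obtain ⟨G, -, hG⟩ := zorn_le_nonempty₀ {G : Submodule Rᵐᵒᵖ (R × R × R) | Valid G}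
    (by
      intro c hc hch y hy
      refine ⟨sSup c, ⟨?_, ?_, ?_⟩, fun z hz => le_sSup hz⟩
      · intro a b b' h
        obtain ⟨z, hz, hxz⟩ := (chain_mem hch hy).1 h
        obtain ⟨⟨p, q, h1⟩, ⟨p', q', h2⟩⟩ := (hc hz).v1 _ _ _ hxz
        exact ⟨⟨p, q, le_sSup hz h1⟩, ⟨p', q', le_sSup hz h2⟩⟩
      · intro b b' h
        obtain ⟨z, hz, hxz⟩ := (chain_mem hch hy).1 h
        exact (hc hz).v2 _ _ hxz
      · intro a1 b1 c1 a2 b2 c2 h h' h0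
        obtain ⟨z, hz, hxz⟩ := (chain_mem hch hy).1 h
        obtain ⟨z', hz', hxz'⟩ := (chain_mem hch hy).1 h'
        obtain ⟨m, hm, hm1, hm2⟩ := hch.directedOn z hz z' hz'
        exact (hc hm).v3 _ _ _ _ _ _ (hm1 hxz) (hm2 hxz') h0) ⊥ (by
      refine ⟨?_, ?_, ?_⟩
      · intro a b b' h
        simp at h
        obtain ⟨rfl, rfl, rfl⟩ := h
        exact ⟨⟨0, 0, by simp⟩, ⟨0, 0, by simp⟩⟩
      · intro b b' h
        simpa using h
      · intro a1 b1 c1 a2 b2 c2 h h' h0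
        simp at h h'
        simp [h, h'])
  obtain ⟨hv, hmax⟩ := hG
  obtain ⟨c, s1, s2, t1, t2, hpi, hc⟩ := pi_of_valid hreg hinj G hv
  refine ⟨c, s1, s2, t1, t2, hpi, ?_⟩
  intro d x1 x2 y1 y2 hd cd dc
  have hV := valid_of_pi (pi_add hpi hd cd dc)
  have hle := hmax hV (by
    rintro ⟨a, b, b'⟩ h
    obtain ⟨h1, h2, h3⟩ := hc _ _ _ h
    have da : d * a = 0 := by rw [← h1, as dc, zero_mul]
    have x1a : x1 * a = 0 := by rw [← hd.s1c, mul_assoc, da, mul_zero]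
    have x2a : x2 * a = 0 := by rw [← hd.s2c, mul_assoc, da, mul_zero]
    exact ⟨a, by simp [add_mul, h1, h2, h3, da, x1a, x2a]⟩)
  have : (d, x1, x2) ∈ G := hle ⟨d, by
    simp [add_mul, cd, hd.cc, hd.s1c, hd.s2c]
    constructor
    · rw [← hpi.s1c, mul_assoc, cd, mul_zero]
    · rw [← hpi.s2c, mul_assoc, cd, mul_zero]⟩
  rw [← (hc _ _ _ this).1, cd]

lemma exists_pi {R : Type u} [Ring R] (hreg : ∀ a : R, ∃ b : R, a * b * a = a)
    (hinj : Module.Injective Rᵐᵒᵖ R) (e x y : R) (he : e * e = e) (hec : ∀ z, e * z = z * e)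
    (yx : y * x = e) (ex : e * x = x) (ey : e * y = y) (hne : x * y ≠ e) :
    ∃ d s1 s2 t1 t2 : R, PI d s1 s2 t1 t2 ∧ e * d = d ∧ d ≠ 0 := by
  have xe : x * e = x := by rw [← hec, ex]
  have ye : y * e = y := by rw [← hec, ey]
  obtain ⟨g, hg⟩ : ∃ g, g = e - x * y := ⟨_, rfl⟩
  have g0 : g ≠ 0 := by
    rw [hg]; exact fun h => hne (sub_eq_zero.1 h).symm
  have eg : e * g = g := by rw [hg, mul_sub, he, as ex]
  have ge : g * e = g := by rw [← hec, eg]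
  have yg : y * g = 0 := by rw [hg, mul_sub, ye, as yx, ey, sub_self]
  have gx : g * x = 0 := by rw [hg, sub_mul, ex, mul_assoc, yx, xe, sub_self]
  have gg : g * g = g := by
    nth_rw 2 [hg]
    rw [mul_sub, ge, as gx, zero_mul, sub_zero]
  have exn : ∀ n, e * (x ^ n * g) = x ^ n * g := by
    intro n
    rw [← mul_assoc, hec, mul_assoc, eg]
  have h1 : ∀ m k, y ^ m * (x ^ (m + k) * g) = x ^ k * g := by
    intro m
    induction m with
    | zero => intro k; simp
    | succ m ih =>
      intro k
      have : x ^ (m + 1 + k) = x * x ^ (m + k) := by rw [← pow_succ']; congr 1; omega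
      rw [pow_succ, this, mul_assoc, mul_assoc, as yx, exn, ih]
  have hYX : ∀ m n, m ≠ n → g * y ^ m * (x ^ n * g) = 0 := by
    intro m n hmn
    rcases lt_or_gt_of_ne hmn with h | h
    · obtain ⟨k, rfl⟩ := Nat.exists_eq_add_of_lt h
      rw [mul_assoc, add_assoc, h1, pow_succ', mul_assoc, as gx, zero_mul]
    · obtain ⟨k, rfl⟩ := Nat.exists_eq_add_of_lt h
      have : y ^ (n + k + 1) = y ^ k * y * y ^ n := by
        rw [← pow_succ, ← pow_add]; congr 1; omega
      have h2 := h1 n 0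
      simp only [add_zero, pow_zero, one_mul] at h2
      rw [this]
      simp only [mul_assoc, h2, yg, mul_zero]
  have hYX' : ∀ n, g * y ^ n * (x ^ n * g) = g := by
    intro n
    have h2 := h1 n 0
    simp only [add_zero, pow_zero, one_mul] at h2
    rw [mul_assoc, h2, gg]
  let F : (ℕ → ℕ) → (ℕ →₀ R) →ₗ[Rᵐᵒᵖ] R := fun k => Finsupp.lsum ℕ (fun n => L (x ^ (k n) * g))
  have Fs : ∀ k n a, F k (Finsupp.single n a) = x ^ (k n) * g * a := by
    intro k n a; simp [F]
  have coef : ∀ k : ℕ → ℕ, Function.Injective k → ∀ m r, g * y ^ (k m) * F k r = g * r m := by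
    intro k hk m r
    induction r using Finsupp.induction_linear with
    | zero => simp
    | add p q hp hq => rw [map_add, mul_add, hp, hq, Finsupp.add_apply, mul_add]
    | single n a =>
      rw [Fs, ← mul_assoc]
      by_cases h : n = m
      · subst h; rw [hYX']; simp
      · rw [hYX _ _ (fun h' => h (hk h').symm), Finsupp.single_eq_of_ne (Ne.symm h)]; simp
  have coef0 : ∀ (k : ℕ → ℕ) (m : ℕ), (∀ n, m ≠ k n) → ∀ r, g * y ^ m * F k r = 0 := by
    intro k m hk r
    induction r using Finsupp.induction_linear with
    | zero => simp
    | add p q hp hq => rw [map_add, mul_add, hp, hq, add_zero]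
    | single n a => rw [Fs, ← mul_assoc, hYX _ _ (hk n), zero_mul]
  have Fzero : ∀ k r, (∀ m, g * r m = 0) → F k r = 0 := by
    intro k r hr
    simp only [F, Finsupp.lsum_apply, Finsupp.sum]
    apply Finset.sum_eq_zero
    intro n _
    rw [L_apply, mul_assoc, hr, mul_zero]
  have Fmap : ∀ k r, F id (r.mapDomain k) = F k r := by
    intro k r
    induction r using Finsupp.induction_linear with
    | zero => simp
    | add p q hp hq => rw [Finsupp.mapDomain_add, map_add, map_add, hp, hq]
    | single n a => rw [Finsupp.mapDomain_single, Fs, Fs]; rfl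
  have i2 : Function.Injective (fun n : ℕ => 2 * n) := fun a b h => by simp at h; omega
  have i3 : Function.Injective (fun n : ℕ => 2 * n + 1) := fun a b h => by simp at h; omega
  let G : Submodule Rᵐᵒᵖ (R × R × R) :=
    LinearMap.range ((F id).prod ((F (fun n => 2 * n)).prod (F (fun n => 2 * n + 1))))
  have memG : ∀ r, (F id r, F (fun n => 2 * n) r, F (fun n => 2 * n + 1) r) ∈ G := fun r => ⟨r, rfl⟩
  have hG : Valid G := by
    refine ⟨?_, ?_, ?_⟩
    · rintro a b b' ⟨r, hr⟩
      simp only [LinearMap.prod_apply, Function.prod_apply, Prod.mk.injEq] at hr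
      obtain ⟨rfl, rfl, rfl⟩ := hr
      constructor
      · have h5 := memG (r.mapDomain (fun n => 2 * n))
        rw [Fmap] at h5
        exact ⟨_, _, h5⟩
      · have h5 := memG (r.mapDomain (fun n => 2 * n + 1))
        rw [Fmap] at h5
        exact ⟨_, _, h5⟩
    · rintro b b' ⟨r, hr⟩
      simp only [LinearMap.prod_apply, Function.prod_apply, Prod.mk.injEq] at hr
      obtain ⟨h0, rfl, rfl⟩ := hr
      have : ∀ m, g * r m = 0 := by
        intro m
        rw [← coef id Function.injective_id m r, h0, mul_zero]
      exact ⟨Fzero _ _ this, Fzero _ _ this⟩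
    · rintro a1 b1 c1 a2 b2 c2 ⟨r, hr⟩ ⟨r', hr'⟩ h0
      simp only [LinearMap.prod_apply, Function.prod_apply, Prod.mk.injEq] at hr hr'
      obtain ⟨rfl, rfl, rfl⟩ := hr
      obtain ⟨rfl, rfl, rfl⟩ := hr'
      constructor
      · apply Fzero
        intro m
        have h5 := congrArg (g * y ^ (2 * m) * ·) h0
        simp only [mul_add, mul_zero] at h5
        rw [coef _ i2 m, coef0 _ _ (fun n => by omega), add_zero] at h5
        exact h5
      · apply Fzero
        intro m
        have h5 := congrArg (g * y ^ (2 * m + 1) * ·) h0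
        simp only [mul_add, mul_zero] at h5
        rw [coef _ i3 m, coef0 _ _ (fun n => by omega), zero_add] at h5
        exact h5
  obtain ⟨c, s1, s2, t1, t2, hpi, hc⟩ := pi_of_valid hreg hinj G hG
  refine ⟨_, _, _, _, _, pi_central e he hec hpi, by rw [← mul_assoc, he], fun h0 => g0 ?_⟩
  have : c * g = g := by
    have h5 := (hc _ _ _ (memG (Finsupp.single 0 1))).1
    rw [Fs] at h5
    simpa using h5
  rw [← eg, ← this, ← mul_assoc, h0, zero_mul]

lemma xy_of_infinite {R : Type u} [Ring R] (e : R) (he : e * e = e)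
    (h : DirectlyInfinite Rᵐᵒᵖ ↥(Submodule.span Rᵐᵒᵖ ({e} : Set R))) :
    ∃ x y : R, y * x = e ∧ e * x = x ∧ e * y = y ∧ x * y ≠ e := by
  obtain ⟨B, _, _, hB, ⟨φ⟩⟩ := h
  have hem : e ∈ Submodule.span Rᵐᵒᵖ ({e} : Set R) := Submodule.mem_span_singleton_self e
  have hmem : ∀ v ∈ Submodule.span Rᵐᵒᵖ ({e} : Set R), e * v = v := by
    intro v hv
    obtain ⟨r, rfl⟩ := Submodule.mem_span_singleton.1 hv
    rw [MulOpposite.smul_eq_mul_unop, ← mul_assoc, he]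
  let E : Submodule.span Rᵐᵒᵖ ({e} : Set R) := ⟨e, hem⟩
  have hE : ∀ v : Submodule.span Rᵐᵒᵖ ({e} : Set R), v = MulOpposite.op (v : R) • E := by
    intro v
    ext
    simp [E, hmem v v.2]
  let α : Submodule.span Rᵐᵒᵖ ({e} : Set R) →ₗ[Rᵐᵒᵖ] Submodule.span Rᵐᵒᵖ ({e} : Set R) :=
    φ.symm.toLinearMap.comp (LinearMap.inl Rᵐᵒᵖ _ B)
  let β : Submodule.span Rᵐᵒᵖ ({e} : Set R) →ₗ[Rᵐᵒᵖ] Submodule.span Rᵐᵒᵖ ({e} : Set R) :=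
    (LinearMap.fst Rᵐᵒᵖ _ B).comp φ.toLinearMap
  have hβ : ∀ v, ((β v : Submodule.span Rᵐᵒᵖ ({e} : Set R)) : R) = (β E : R) * v := by
    intro v
    conv_lhs => rw [hE v]
    rw [map_smul]
    simp
  obtain ⟨b, hb⟩ := exists_ne (0 : B)
  let v0 := φ.symm (0, b)
  have hv0 : β v0 = 0 := by simp [β, v0]
  have hv0' : v0 ≠ 0 := by
    intro h
    have : φ v0 = 0 := by rw [h, map_zero]
    simp [v0] at this
    exact hb this
  refine ⟨α E, β E, ?_, hmem _ (α E).2, hmem _ (β E).2, ?_⟩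
  · rw [← hβ]
    simp [α, β, E]
  · intro h
    apply hv0'
    ext
    have h2 := hβ v0
    rw [hv0] at h2
    have h3 := hmem _ v0.2
    have h4 : e * (v0 : R) = (α E : R) * (β E : R) * v0 := congrArg (· * (v0 : R)) h.symm
    rw [← h3, h4, mul_assoc, ← h2]
    simp

lemma exists_iso {R : Type u} [Ring R]
    (hreg : ∀ a : R, ∃ b : R, a * b * a = a)
    (hinj : Module.Injective Rᵐᵒᵖ R)
    (hdf : ∀ e : R, IsIdempotentElem e → (∀ x : R, e * x = x * e) → e ≠ 0 →
      DirectlyInfinite Rᵐᵒᵖ ↥(Submodule.span Rᵐᵒᵖ ({e} : Set R))) :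
    ∃ s1 s2 t1 t2 : R, t1 * s1 = 1 ∧ t1 * s2 = 0 ∧ t2 * s1 = 0 ∧ t2 * s2 = 1 := by
  obtain ⟨c, s1, s2, t1, t2, hpi, hmax⟩ := exists_max hreg hinj
  have hmax' : ∀ d x1 x2 y1 y2 x y : R, PI d x1 x2 y1 y2 → d = x * (1 - c) * y → d = 0 := by
    intro d x1 x2 y1 y2 x y hd hxy
    have c1 : c * (1 - c) = 0 := by rw [mul_sub, hpi.cc]; simp
    have c2 : (1 - c) * c = 0 := by rw [sub_mul, hpi.cc]; simp
    have c3 : (1 - c) * (1 - c) = 1 - c := by rw [mul_sub, c2]; simp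
    have vu : (d * x * (1 - c)) * ((1 - c) * y * d) = d := by
      calc (d * x * (1 - c)) * ((1 - c) * y * d) = d * (x * ((1 - c) * (1 - c)) * y) * d := by
            simp only [mul_assoc]
        _ = d := by rw [c3, ← hxy, hd.cc, hd.cc]
    have h0 := hmax _ _ _ _ _ (pi_transport hd vu) (by simp only [← mul_assoc, c1, zero_mul])
      (by simp only [mul_assoc, c2, mul_zero])
    have h1 : (d * x * (1 - c)) * ((1 - c) * y * d * d * (d * x * (1 - c))) * ((1 - c) * y * d) = d := by
      calc _ = ((d * x * (1 - c)) * ((1 - c) * y * d)) * d *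
            ((d * x * (1 - c)) * ((1 - c) * y * d)) := by simp only [mul_assoc]
        _ = d := by rw [vu, hd.cc, hd.cc]
    rw [← h1, h0]; simp
  obtain ⟨w, hw, hwc, ⟨x, y, h1⟩, ⟨x', y', h2⟩⟩ := comp hreg hinj (1 - c) c
  have hw' : (1 - w) * (1 - w) = 1 - w := by
    rw [mul_sub, sub_mul, sub_mul, hw]; simp
  have hwc' : ∀ x, (1 - w) * x = x * (1 - w) := by
    intro x; rw [sub_mul, mul_sub, hwc]; simp
  have h3 : (1 - w) * c = 0 := hmax' _ _ _ _ _ _ _ (pi_central _ hw' hwc' hpi) h2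
  have h4 : 1 - w = 0 := by
    by_contra hne
    obtain ⟨p, q, a1, a2, a3, a4⟩ := xy_of_infinite (1 - w) hw' (hdf _ hw' hwc' hne)
    obtain ⟨d, z1, z2, z3, z4, hd, hd1, hd0⟩ := exists_pi hreg hinj _ _ _ hw' hwc' a1 a2 a3 a4
    apply hd0
    apply hmax' _ _ _ _ _ (1 - w) d hd
    rw [mul_sub, h3, mul_one, sub_zero, hd1]
  have h5 : w = 1 := (sub_eq_zero.1 h4).symm
  rw [h5, one_mul] at h1
  obtain ⟨U, hU⟩ : ∃ U, U = s1 + s2 * y * (1 - c) := ⟨_, rfl⟩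
  obtain ⟨V, hV⟩ : ∃ V, V = t1 + (1 - c) * x * t2 := ⟨_, rfl⟩
  have c2 : (1 - c) * (1 - c) = 1 - c := by rw [mul_sub, sub_mul, sub_mul, hpi.cc]; simp
  have cU : c * U = U := by rw [hU, mul_add, mul_assoc, as hpi.cs2, hpi.cs1]
  have VU : V * U = 1 := by
    have e1 : (1 - c) * (x * (c * (y * (1 - c)))) = 1 - c := by
      calc _ = (1 - c) * (x * c * y) * (1 - c) := by simp only [mul_assoc]
        _ = _ := by rw [← h1, c2, c2]
    rw [hU, hV, add_mul, mul_add, mul_add]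
    simp only [mul_assoc, hpi.t1s1, hpi.t2s1, as hpi.t1s2, as hpi.t2s2, e1]
    simp
  refine ⟨s1 * U, s2 * U, V * t1, V * t2, ?_, ?_, ?_, ?_⟩
  · rw [mul_assoc, as hpi.t1s1, cU, VU]
  · rw [mul_assoc, as hpi.t1s2]; simp
  · rw [mul_assoc, as hpi.t2s1]; simp
  · rw [mul_assoc, as hpi.t2s2, cU, VU]

lemma split_one {S : Type u} [Ring S] (hreg : ∀ a : S, ∃ b : S, a * b * a = a)
    (hcomp : ∀ a b : S, (∃ x y, a = x * b * y) ∨ ∃ x y, b = x * a * y)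
    {s1 s2 t1 t2 : S} (h11 : t1 * s1 = 1) (h21 : t2 * s1 = 0)
    (h22 : t2 * s2 = 1) (c d : S) (hcd : c + d = 1) :
    (∃ x y, x * c * y = 1) ∨ ∃ x y, x * d * y = 1 := by
  obtain ⟨c', hc'⟩ := hreg c
  obtain ⟨p, hp⟩ : ∃ p, p = c * c' := ⟨_, rfl⟩
  obtain ⟨q, hq⟩ : ∃ q, q = 1 - p := ⟨_, rfl⟩
  have pp : p * p = p := by rw [hp, ← mul_assoc, hc']
  have qq : q * q = q := by rw [hq]; simp only [mul_sub, sub_mul, mul_one, one_mul, pp]; simp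
  have qp : q * p = 0 := by rw [hq, sub_mul, pp]; simp
  have pq1 : p + q = 1 := by rw [hq]; simp
  have qd : q = q * d := by
    have qc : q * c = 0 := by rw [hq, sub_mul, hp, hc']; simp
    calc q = q * (c + d) := by rw [hcd, mul_one]
      _ = _ := by rw [mul_add, qc, zero_add]
  suffices h : (∃ x y, x * p * y = 1) ∨ ∃ x y, x * q * y = 1 by
    rcases h with ⟨x, y, h⟩ | ⟨x, y, h⟩
    · left; exact ⟨x, c' * y, by rw [← h, hp]; simp only [mul_assoc]⟩
    · right; exact ⟨x * q, y, by rw [← h, mul_assoc x, ← qd]⟩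
  obtain ⟨a, ha⟩ : ∃ a, a = q * s1 := ⟨_, rfl⟩
  obtain ⟨b0, hb0⟩ := hreg a
  have qa : q * a = a := by rw [ha, ← mul_assoc, qq]
  obtain ⟨b, hb⟩ : ∃ b, b = b0 * a * b0 * q := ⟨_, rfl⟩
  have hb0' : a * (b0 * a) = a := by rw [← mul_assoc, hb0]
  have hb0'' : ∀ z, a * (b0 * (a * z)) = a * z := fun z => by simp only [← mul_assoc, hb0]
  have aba : a * (b * a) = a := by
    rw [hb]; simp only [mul_assoc, qa, hb0', hb0'']
  have bab : b * (a * b) = b := by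
    rw [hb]; simp only [mul_assoc, as qa, hb0', hb0'']
  have bq : b * q = b := by rw [hb, mul_assoc, qq]
  obtain ⟨k, hk⟩ : ∃ k, k = 1 - b * a := ⟨_, rfl⟩
  obtain ⟨r, hr⟩ : ∃ r, r = q - a * b := ⟨_, rfl⟩
  have kk : k * k = k := by
    rw [hk]; simp only [mul_sub, sub_mul, mul_one, one_mul, mul_assoc, aba]; simp
  have rr : r * r = r := by
    rw [hr, mul_sub, sub_mul, sub_mul, qq, as qa, mul_assoc, mul_assoc, bq, bab]; simp
  have ak : a * k = 0 := by rw [hk, mul_sub, aba]; simp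
  have br : b * r = 0 := by rw [hr, mul_sub, bq, bab]; simp
  have ra : r * a = 0 := by rw [hr, sub_mul, mul_assoc, aba, qa]; simp
  have qr : q * r = r := by rw [hr, mul_sub, qq, as qa]
  rcases hcomp k r with ⟨x0, y0, h⟩ | ⟨x0, y0, h⟩
  · right
    have hxy : (k * x0 * r) * (r * y0 * k) = k := by
      calc _ = k * (x0 * (r * r) * y0) * k := by simp only [mul_assoc]
        _ = k := by rw [rr, ← h, kk, kk]
    refine ⟨b + k * x0 * r, a + r * y0 * k, ?_⟩
    rw [mul_assoc, mul_add q, qa, mul_assoc r, as qr, ← mul_assoc r, add_mul, mul_add, mul_add,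
      hxy, mul_assoc r, as br, mul_assoc _ r a, ra, hk]
    simp
  · left
    obtain ⟨x, hx⟩ : ∃ x, x = r * x0 * k := ⟨_, rfl⟩
    obtain ⟨y, hy⟩ : ∃ y, y = k * y0 * r := ⟨_, rfl⟩
    have hxy : x * y = r := by
      rw [hx, hy]
      calc _ = r * (x0 * (k * k) * y0) * r := by simp only [mul_assoc]
        _ = r := by rw [kk, ← h, rr, rr]
    have ky : k * y = y := by rw [hy]; simp only [← mul_assoc, kk]
    have rx : r * x = x := by rw [hx]; simp only [← mul_assoc, rr]
    have psk : p * (s1 * k) = s1 * k := by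
      have : q * (s1 * k) = 0 := by rw [← mul_assoc, ← ha, ak]
      rw [hq, sub_mul, one_mul, sub_eq_zero] at this
      exact this.symm
    have psy : p * (s1 * y) = s1 * y := by
      rw [← ky, ← mul_assoc s1, ← mul_assoc p, psk]
    obtain ⟨Ψ, hΨ⟩ : ∃ Ψ, Ψ = t2 * (p + x * t1) := ⟨_, rfl⟩
    have e1 : Ψ * (s1 * y) = t2 * r := by
      rw [hΨ, mul_assoc, add_mul, psy, mul_assoc, as h11, one_mul, hxy, mul_add, as h21]
      simp
    have e2 : Ψ * (p - s1 * y * x * t1 * p) = t2 * p := by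
      have : Ψ * (s1 * y * x * t1 * p) = t2 * x * t1 * p := by
        calc _ = Ψ * (s1 * y) * x * t1 * p := by simp only [mul_assoc]
          _ = _ := by rw [e1, mul_assoc t2, rx]
      rw [mul_sub, this, hΨ, mul_assoc, add_mul, pp, mul_add]
      simp only [mul_assoc]; simp
    have e3 : t2 * (a * b) = - (t2 * p * s1 * b) := by
      rw [ha, hq, sub_mul, sub_mul, mul_sub, one_mul, as h21]
      simp only [mul_assoc]; simp
    obtain ⟨Z, hZ⟩ : ∃ Z, Z = (p - s1 * y * x * t1 * p) * (1 - s1 * b) * s2 + s1 * y * s2 :=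
      ⟨_, rfl⟩
    have pZ : p * Z = Z := by
      have psy' : p * (s1 * y) = s1 * y := psy
      have : p * (p - s1 * y * x * t1 * p) = p - s1 * y * x * t1 * p := by
        rw [mul_sub, pp]; simp only [← mul_assoc] at psy' ⊢; rw [psy']
      rw [hZ, mul_add]
      simp only [← mul_assoc] at this psy' ⊢
      rw [this, psy']
    refine ⟨Ψ, Z, ?_⟩
    rw [mul_assoc, pZ, hZ, mul_add]
    have e4 : t2 * (1 : S) = t2 * p + t2 * (a * b) + t2 * r := by
      rw [← mul_add, ← mul_add, hr, add_assoc, add_sub_cancel, pq1]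
    calc Ψ * ((p - s1 * y * x * t1 * p) * (1 - s1 * b) * s2) + Ψ * (s1 * y * s2)
        = Ψ * (p - s1 * y * x * t1 * p) * (1 - s1 * b) * s2 + Ψ * (s1 * y) * s2 := by
          simp only [mul_assoc]
      _ = t2 * p * (1 - s1 * b) * s2 + t2 * r * s2 := by rw [e1, e2]
      _ = (t2 * p + t2 * (a * b) + t2 * r) * s2 := by
          rw [e3, mul_sub, mul_one, add_mul _ (t2 * r)]
          simp only [← mul_assoc, sub_eq_add_neg]
      _ = 1 := by rw [← e4, mul_one, h22]

lemma simple_pi {S : Type u} [Ring S] [IsSimpleRing S] (hreg : ∀ a : S, ∃ b : S, a * b * a = a)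
    (hcomp : ∀ a b : S, (∃ x y, a = x * b * y) ∨ ∃ x y, b = x * a * y)
    {s1 s2 t1 t2 : S} (h11 : t1 * s1 = 1) (h21 : t2 * s1 = 0)
    (h22 : t2 * s2 = 1) : PurelyInfiniteSimple S := by
  have h10 : (1 : S) ≠ 0 := one_ne_zero
  let I : TwoSidedIdeal S := TwoSidedIdeal.mk' {c | ∀ x y, x * c * y ≠ 1}
    (by intro x y; simp [h10.symm])
    (by
      intro a b ha hb x y h
      rcases split_one hreg hcomp h11 h21 h22 (x * a * y) (x * b * y)
        (by rw [← h, mul_add, add_mul]) with ⟨z, w, h⟩ | ⟨z, w, h⟩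
      · exact ha (z * x) (y * w) (by rw [← h]; simp only [mul_assoc])
      · exact hb (z * x) (y * w) (by rw [← h]; simp only [mul_assoc]))
    (by
      intro a ha x y h
      exact ha (-x) y (by rw [← h]; simp))
    (by
      intro a b hb x y h
      exact hb (x * a) y (by rw [← h]; simp only [mul_assoc]))
    (by
      intro a b hb x y h
      exact hb x (b * y) (by rw [← h]; simp only [mul_assoc]))
  have hI : I = ⊥ := by
    rcases eq_bot_or_eq_top I with h | h
    · exact h
    · have h1 : (1 : S) ∈ I := by rw [h]; trivial
      rw [TwoSidedIdeal.mem_mk'] at h1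
      exact absurd (by simp) (h1 1 1)
  refine ⟨inferInstance, fun J hJ => ?_⟩
  obtain ⟨a, haJ, ha0⟩ := Submodule.exists_mem_ne_zero_of_ne_bot hJ
  obtain ⟨b, hb⟩ := hreg a
  obtain ⟨e, he⟩ : ∃ e, e = a * b := ⟨_, rfl⟩
  have ee : e * e = e := by rw [he, ← mul_assoc, hb]
  have e0 : e ≠ 0 := by
    rintro rfl
    rw [← he, zero_mul] at hb
    exact ha0 hb.symm
  have heI : e ∉ I := by rw [hI, TwoSidedIdeal.mem_bot]; exact e0
  rw [TwoSidedIdeal.mem_mk'] at heI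
  obtain ⟨x, y, hxy⟩ : ∃ x y, x * e * y = 1 := by
    by_contra hcon
    push Not at hcon
    exact heI hcon
  have hxy' : x * (e * y) = 1 := by rw [← mul_assoc, hxy]
  refine ⟨e, by rw [he]; exact smul_mem' J haJ b, ee, ?_⟩
  obtain ⟨u, hu⟩ : ∃ u, u = e * y * s1 * e := ⟨_, rfl⟩
  obtain ⟨v, hv⟩ : ∃ v, v = e * t1 * x * e := ⟨_, rfl⟩
  have vu : v * u = e := by
    rw [hu, hv]
    calc _ = e * t1 * (x * (e * e) * y) * s1 * e := by simp only [mul_assoc]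
      _ = e * (t1 * s1) * e := by rw [ee, hxy]; simp only [mul_assoc, one_mul]
      _ = e := by rw [h11, mul_one, ee]
  have eu : e * u = u := by rw [hu]; simp only [← mul_assoc, ee]
  have ue : u * e = u := by rw [hu]; simp only [mul_assoc, ee]
  have ev : e * v = v := by rw [hv]; simp only [← mul_assoc, ee]
  have ve : v * e = v := by rw [hv]; simp only [mul_assoc, ee]
  have ff : (u * v) * (u * v) = u * v := by rw [mul_assoc, as vu, ev]
  refine ⟨u * v, e - u * v, ff, ?_, ?_, ?_, by simp, ?_, ?_⟩
  · change _ * _ = _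
    rw [mul_sub, sub_mul, sub_mul, ff, ee, as eu, mul_assoc, ve]; simp
  · rw [mul_sub, ff, mul_assoc, ve, sub_self]
  · rw [sub_mul, ff, as eu, sub_self]
  · intro h
    have h5 : t2 * x * (e - u * v) * (e * y * s2) = 1 := by
      have z1 : t2 * x * u = 0 := by
        rw [hu]
        calc _ = t2 * (x * e * y) * s1 * e := by simp only [mul_assoc]
          _ = 0 := by rw [hxy, mul_one, h21, zero_mul]
      rw [mul_sub, ← mul_assoc _ u, z1, zero_mul, sub_zero]
      calc _ = t2 * (x * (e * e) * y) * s2 := by simp only [mul_assoc]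
        _ = 1 := by rw [ee, hxy, mul_one, h22]
    rw [h] at h5
    simp at h5
  · refine ⟨v, u, ?_, ?_, vu, rfl⟩
    · rw [ev, as vu, ev]
    · rw [mul_assoc, ue, mul_assoc, vu, ue]

lemma simple_quot {R : Type u} [Ring R] (M : TwoSidedIdeal R) (hM : IsCoatom M) :
    IsSimpleRing M.ringCon.Quotient := by
  have hker : ∀ x, M.ringCon.mk' x = 0 ↔ x ∈ M := by
    intro x
    rw [← TwoSidedIdeal.mem_ker, TwoSidedIdeal.ker_ringCon_mk']
  have hsurj : Function.Surjective M.ringCon.mk' := Quotient.mk_surjective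
  have hnt : (1 : R) ∉ M := by
    rw [TwoSidedIdeal.one_mem_iff]; exact hM.1
  haveI : Nontrivial (TwoSidedIdeal M.ringCon.Quotient) := ⟨⊥, ⊤, by
    intro h
    apply hnt
    rw [← hker, ← TwoSidedIdeal.mem_bot, h]
    trivial⟩
  refine ⟨⟨fun I => ?_⟩⟩
  · skip
    have hle : M ≤ I.comap M.ringCon.mk' := by
      intro x hx
      rw [TwoSidedIdeal.mem_comap, (hker x).2 hx]
      exact I.zero_mem
    rcases hM.le_iff.1 hle with h | h
    · right
      rw [← TwoSidedIdeal.one_mem_iff]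
      have : (1 : R) ∈ I.comap M.ringCon.mk' := by rw [h]; trivial
      rw [TwoSidedIdeal.mem_comap] at this
      simpa using this
    · left
      ext z
      obtain ⟨x, rfl⟩ := hsurj z
      rw [TwoSidedIdeal.mem_bot, hker, ← TwoSidedIdeal.mem_comap, h]

end PIS

theorem stmt5 {R : Type u} [Ring R]
    (hreg : ∀ a : R, ∃ b : R, a * b * a = a)
    (hinj : Module.Injective Rᵐᵒᵖ R)
    (hdf : ∀ e : R, IsIdempotentElem e → (∀ x : R, e * x = x * e) → e ≠ 0 →
      DirectlyInfinite Rᵐᵒᵖ ↥(Submodule.span Rᵐᵒᵖ ({e} : Set R)))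
    (M : TwoSidedIdeal R) (hM : IsCoatom M) :
    PurelyInfiniteSimple M.ringCon.Quotient := by
  haveI := PIS.simple_quot M hM
  have hsurj : Function.Surjective M.ringCon.mk' := Quotient.mk_surjective
  obtain ⟨s1, s2, t1, t2, h11, h12, h21, h22⟩ := PIS.exists_iso hreg hinj hdf
  generalize hπ : M.ringCon.mk' = π at hsurj
  have hreg' : ∀ a : M.ringCon.Quotient, ∃ b, a * b * a = a := by
    intro a
    obtain ⟨a, rfl⟩ := hsurj a
    obtain ⟨b, hb⟩ := hreg a
    exact ⟨π b, by rw [← map_mul, ← map_mul, hb]⟩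
  have hcen : ∀ w : M.ringCon.Quotient, w * w = w → (∀ x, w * x = x * w) → w = 0 ∨ w = 1 := by
    intro w hw hwc
    let I : TwoSidedIdeal M.ringCon.Quotient := TwoSidedIdeal.mk' {c | w * c = 0}
      (by simp)
      (by intro x y (hx : _ = _) (hy : _ = _); simp [mul_add, hx, hy])
      (by intro x (hx : _ = _); simp [hx])
      (by
        intro x y (hy : _ = _)
        change _ = _
        rw [← mul_assoc, hwc, mul_assoc, hy, mul_zero])
      (by
        intro x y (hx : _ = _)
        change _ = _
        rw [← mul_assoc, hx, zero_mul])
    have hmem : ∀ x, x ∈ I ↔ w * x = 0 := fun x => by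
      rw [TwoSidedIdeal.mem_mk']; rfl
    have h1 : (1 - w) ∈ I := by rw [hmem, mul_sub, hw]; simp
    rcases eq_bot_or_eq_top I with h | h
    · right
      rw [h, TwoSidedIdeal.mem_bot, sub_eq_zero] at h1
      exact h1.symm
    · left
      have : (1 : M.ringCon.Quotient) ∈ I := by rw [h]; trivial
      rw [hmem] at this
      simpa using this
  have hcomp : ∀ a b : M.ringCon.Quotient,
      (∃ x y, a = x * b * y) ∨ ∃ x y, b = x * a * y := by
    intro a b
    obtain ⟨a, rfl⟩ := hsurj a
    obtain ⟨b, rfl⟩ := hsurj b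
    obtain ⟨w, hw, hwc, ⟨x, y, h1⟩, ⟨x', y', h2⟩⟩ := PIS.comp hreg hinj a b
    have h1' := congrArg π h1
    have h2' := congrArg π h2
    simp only [map_mul, map_sub, map_one] at h1' h2'
    rcases hcen (π w) (by rw [← map_mul, hw]) (by
      intro z
      obtain ⟨z, rfl⟩ := hsurj z
      rw [← map_mul, hwc, map_mul]) with h | h
    · right
      rw [h, sub_zero, one_mul] at h2'
      exact ⟨_, _, h2'⟩
    · left
      rw [h, one_mul] at h1'
      exact ⟨_, _, h1'⟩
  exact PIS.simple_pi hreg' hcomp (s1 := π s1) (s2 := π s2) (t1 := π t1) (t2 := π t2)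
    (by rw [← map_mul, h11, map_one]) (by rw [← map_mul, h21, map_zero])
    (by rw [← map_mul, h22, map_one])
end

section
/- Let R be a von Neumann regular ring which is directly infinite as a right module over itself, and suppose that every finitely generated projective right R-module is free. Then R is a purely infinite simple ring. -/
universe u v w

theorem aux_basis {R : Type u} [Ring R]
    (hfree : ∀ (P : Type u) [AddCommGroup P] [Module Rᵐᵒᵖ P],
      Module.Finite Rᵐᵒᵖ P → Module.Projective Rᵐᵒᵖ P → Module.Free Rᵐᵒᵖ P)
    (e : R) (he : e * e = e) (h0 : e ≠ 0) : ∃ b y : R, b = e * b ∧ y * b = 1 := by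
  let L : R →ₗ[Rᵐᵒᵖ] R :=
    { toFun := fun r => e * r
      map_add' := fun a b => mul_add e a b
      map_smul' := fun m a => by simp [mul_assoc] }
  let M := LinearMap.range L
  have hL : ∀ r, L r = e * r := fun _ => rfl
  let E : Rᵐᵒᵖ ≃ₗ[Rᵐᵒᵖ] R :=
    { toFun := fun r => r.unop
      invFun := fun r => MulOpposite.op r
      left_inv := fun _ => rfl
      right_inv := fun _ => rfl
      map_add' := fun a b => rfl
      map_smul' := fun m a => by simp }
  have hfR : Module.Finite Rᵐᵒᵖ R := Module.Finite.equiv E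
  have hpR : Module.Projective Rᵐᵒᵖ R := Module.Projective.of_equiv E
  have hM : ∀ m : M, e * (m : R) = m := by
    rintro ⟨m, r, rfl⟩
    simp [hL, ← mul_assoc, he]
  have hfM : Module.Finite Rᵐᵒᵖ M := Module.Finite.range L
  have hpM : Module.Projective Rᵐᵒᵖ M := by
    refine Module.Projective.of_split M.subtype L.rangeRestrict ?_
    ext m
    simpa [hL] using hM m
  have hF := hfree M hfM hpM
  let B := Module.Free.chooseBasis Rᵐᵒᵖ M
  let e' : M := ⟨e, e, he⟩
  have hne : Nonempty (Module.Free.ChooseBasisIndex Rᵐᵒᵖ M) := by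
    by_contra hc
    rw [not_nonempty_iff] at hc
    have : e' = 0 := B.ext_elem (fun i => hc.elim i)
    exact h0 (congrArg Subtype.val this)
  obtain ⟨i⟩ := hne
  refine ⟨(B i : R), (B.coord i e').unop, (hM _).symm, ?_⟩
  have h1 : B i = MulOpposite.op (B i : R) • e' := by
    apply Subtype.ext
    simpa [e'] using (hM (B i)).symm
  have h2 : B.coord i (B i) = 1 := by simp
  rw [h1, map_smul] at h2
  have := congrArg MulOpposite.unop h2
  simpa using this

theorem aux_inf {R : Type u} [Ring R] (hinf : DirectlyInfinite Rᵐᵒᵖ R) :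
    ∃ p q : R, p * q = 1 ∧ q * p ≠ 1 := by
  obtain ⟨B, _, _, hB, ⟨φ⟩⟩ := hinf
  have key : ∀ r : R, φ r = MulOpposite.op r • φ 1 := by
    intro r
    rw [← map_smul]; simp
  refine ⟨(φ 1).1, φ.symm (1, 0), ?_, ?_⟩
  · have := key (φ.symm (1, 0))
    rw [LinearEquiv.apply_symm_apply] at this
    have := congrArg Prod.fst this
    simpa using this.symm
  · intro h
    have h1 : φ.symm ((φ 1).1, 0) = 1 := by
      refine Eq.trans ?_ h
      have : ((φ 1).1, (0 : B)) = MulOpposite.op (φ 1).1 • ((1 : R), (0 : B)) := by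
        ext <;> simp
      rw [this, map_smul]; simp
    have h2 : (φ 1).2 = 0 := by
      have := congrArg φ h1
      rw [LinearEquiv.apply_symm_apply] at this
      rw [← this]
    obtain ⟨b, hb⟩ := exists_ne (0 : B)
    apply hb
    have := key (φ.symm (0, b))
    rw [LinearEquiv.apply_symm_apply] at this
    have := congrArg Prod.snd this
    simpa [h2] using this

/-- A von Neumann regular ring which is directly infinite as a right
module over itself and over which every finitely generated projective right module is
free, is purely infinite simple. -/
theorem stmt6 {R : Type u} [Ring R]
    (hreg : ∀ a : R, ∃ b : R, a * b * a = a)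
    (hinf : DirectlyInfinite Rᵐᵒᵖ R)
    (hfree : ∀ (P : Type u) [AddCommGroup P] [Module Rᵐᵒᵖ P],
      Module.Finite Rᵐᵒᵖ P → Module.Projective Rᵐᵒᵖ P → Module.Free Rᵐᵒᵖ P) :
    PurelyInfiniteSimple R := by
  obtain ⟨p, q, hpq, hqp⟩ := aux_inf hinf
  have hnt : Nontrivial R := ⟨_, _, hqp⟩
  have key : ∀ a : R, a ≠ 0 → ∃ c b y : R, b = a * c * b ∧ y * b = 1 := by
    intro a ha
    obtain ⟨c, hc⟩ := hreg a
    obtain ⟨b, y, h1, h2⟩ := aux_basis hfree (a * c) (by rw [← mul_assoc, hc])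
      (fun h => ha (by rw [← hc, h, zero_mul]))
    exact ⟨c, b, y, h1, h2⟩
  refine ⟨⟨⟨fun I => ?_⟩⟩, fun I hI => ?_⟩
  · by_cases h : ∃ a ∈ I, a ≠ 0
    · right
      obtain ⟨a, haI, ha⟩ := h
      obtain ⟨c, b, y, h1, h2⟩ := key a ha
      have h3 : (1 : R) ∈ I := by
        rw [← h2, h1]
        exact I.mul_mem_left _ _ (I.mul_mem_right _ _ (I.mul_mem_right _ _ haI))
      rw [eq_top_iff]
      intro x _
      simpa using I.mul_mem_left x _ h3
    · left
      push Not at h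
      rw [eq_bot_iff]
      intro x hx
      rw [h x hx]
      exact TwoSidedIdeal.zero_mem _
  · obtain ⟨a, haI, ha⟩ := Submodule.exists_mem_ne_zero_of_ne_bot hI
    obtain ⟨c, b, y, h1, h2⟩ := key a ha
    have r1 : ∀ z, y * (b * z) = z := fun z => by rw [← mul_assoc, h2, one_mul]
    have r2 : ∀ z, p * (q * z) = z := fun z => by rw [← mul_assoc, hpq, one_mul]
    refine ⟨b * y, ?_, ?_, b * q * p * y, b * y - b * q * p * y, ?_, ?_, ?_, ?_, ?_, ?_,
      b * p * y, b * q * y, ?_, ?_, ?_, ?_⟩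
    · have : b * y = MulOpposite.op (c * b * y) • a := by
        rw [MulOpposite.smul_eq_mul_unop, MulOpposite.unop_op, ← mul_assoc, ← mul_assoc, ← h1]
      rw [this]
      exact I.smul_mem _ haI
    · simp only [IsIdempotentElem, mul_assoc, r1]
    · simp only [IsIdempotentElem, mul_assoc, r1, r2]
    · simp only [IsIdempotentElem, mul_assoc, r1, r2, mul_sub, sub_mul]
      abel
    · simp only [mul_assoc, r1, r2, mul_sub, sub_self]
    · simp only [mul_assoc, r1, r2, sub_mul, sub_self]
    · abel
    · intro h
      apply hqp
      have h3 : y * (b * y - b * q * p * y) * b = 0 := by rw [h]; simp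
      simp only [mul_sub, sub_mul, mul_assoc, r1, h2, mul_one] at h3
      exact (sub_eq_zero.mp h3).symm
    all_goals simp only [mul_assoc, r1, r2]
end

section
/- Let A be a simple ring that is directly infinite as a right module over itself. For each n ≥ 0, let ι_n : M_{2^n}(A) → M_{2^{n+1}}(A) denote the unital block-diagonal ring embedding a ↦ diag(a, a). Let B be a nonzero ring equipped with ring homomorphisms f_n : M_{2^n}(A) → B satisfying f_{n+1} ∘ ι_n = f_n for all n, and such that B is the union of the images of the maps f_n. Then B is a purely infinite simple ring. -/
universe u v w

/-- The unital block-diagonal ring embedding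
`M_{2^n}(A) → M_{2^{n+1}}(A)`, `a ↦ diag (a, a)`. -/
def matIota (A : Type u) [Ring A] (n : ℕ) (a : Matrix (Fin (2 ^ n)) (Fin (2 ^ n)) A) :
    Matrix (Fin (2 ^ (n + 1))) (Fin (2 ^ (n + 1))) A :=
  Matrix.reindex (finSumFinEquiv.trans (finCongr (by rw [pow_succ, mul_two])))
    (finSumFinEquiv.trans (finCongr (by rw [pow_succ, mul_two])))
    (Matrix.fromBlocks a 0 0 a)

theorem aux_list {R : Type*} [Ring R] [IsSimpleRing R] {b : R} (hb : b ≠ 0) :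
    ∃ l : List (R × R), (l.map (fun p => p.1 * b * p.2)).sum = 1 := by
  have h1 : (1 : R) ∈ TwoSidedIdeal.span {b} :=
    IsSimpleRing.one_mem_of_ne_zero_mem _ hb (TwoSidedIdeal.subset_span rfl)
  generalize (1 : R) = c at h1
  induction h1 using TwoSidedIdeal.span_induction with
  | mem x h => obtain rfl := h; exact ⟨[(1, 1)], by simp⟩
  | zero => exact ⟨[], by simp⟩
  | add x y hx hy h h' =>
    obtain ⟨l, rfl⟩ := h
    obtain ⟨l', rfl⟩ := h'
    exact ⟨l ++ l', by simp⟩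
  | neg x hx h =>
    obtain ⟨l, rfl⟩ := h
    refine ⟨l.map (fun p => (-p.1, p.2)), ?_⟩
    rw [List.map_map, ← neg_one_mul, ← List.sum_map_mul_left]
    congr 2; funext p; simp
  | left_absorb a x hx h =>
    obtain ⟨l, rfl⟩ := h
    refine ⟨l.map (fun p => (a * p.1, p.2)), ?_⟩
    rw [List.map_map, ← List.sum_map_mul_left]
    congr 2; funext p; simp [mul_assoc]
  | right_absorb a x hx h =>
    obtain ⟨l, rfl⟩ := h
    refine ⟨l.map (fun p => (p.1, p.2 * a)), ?_⟩
    rw [List.map_map, ← List.sum_map_mul_right]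
    congr 2; funext p; simp [mul_assoc]

theorem aux_st {R : Type*} [Ring R] [IsSimpleRing R] {x y : R} (hxy : x * y = 1)
    (hyx : y * x ≠ 1) :
    ∃ s1 s2 t1 t2 : R, t1 * s1 = 1 ∧ t1 * s2 = 0 ∧ t2 * s1 = 0 ∧ t2 * s2 = 1 := by
  have hg : 1 - y * x ≠ 0 := fun h => hyx (sub_eq_zero.1 h).symm
  have h1 : (1 : R) ∈ TwoSidedIdeal.span {1 - y * x} :=
    IsSimpleRing.one_mem_of_ne_zero_mem _ hg (TwoSidedIdeal.subset_span rfl)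
  have hpow : ∀ k : ℕ, x ^ k * y ^ k = 1 := by
    intro k
    induction k with
    | zero => simp
    | succ k ih =>
      rw [pow_succ, pow_succ', mul_assoc, ← mul_assoc x, hxy, one_mul, ih]
  suffices h : ∀ c ∈ TwoSidedIdeal.span {1 - y * x},
      ∃ (k : ℕ) (t s : R), t * s = c ∧ x ^ k * s = 0 ∧ t * y ^ k = 0 by
    obtain ⟨k, t, s, h1, h2, h3⟩ := h 1 h1
    exact ⟨y ^ k, s, x ^ k, t, hpow k, h2, h3, h1⟩
  intro c hc
  induction hc using TwoSidedIdeal.span_induction with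
  | mem z h =>
    obtain rfl := h
    refine ⟨1, 1 - y * x, 1 - y * x, ?_, ?_, ?_⟩
    · have : y * x * (y * x) = y * x := by
        rw [mul_assoc, ← mul_assoc x, hxy, one_mul]
      simp [mul_sub, sub_mul, this]
    · simp [mul_sub, ← mul_assoc, hxy]
    · simp [sub_mul, mul_assoc, hxy]
  | zero => exact ⟨0, 0, 0, by simp, by simp, by simp⟩
  | add c c' _ _ h h' =>
    obtain ⟨k, t, s, rfl, h2, h3⟩ := h
    obtain ⟨k', t', s', rfl, h2', h3'⟩ := h'
    refine ⟨k + k', t + t' * x ^ k, s + y ^ k * s', ?_, ?_, ?_⟩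
    · have e1 : t * (y ^ k * s') = 0 := by rw [← mul_assoc, h3, zero_mul]
      have e2 : t' * x ^ k * s = 0 := by rw [mul_assoc, h2, mul_zero]
      have e3 : t' * x ^ k * (y ^ k * s') = t' * s' := by
        rw [mul_assoc, ← mul_assoc (x ^ k), hpow, one_mul]
      rw [add_mul, mul_add, mul_add, e1, e2, e3]; simp
    · rw [mul_add, add_comm k, pow_add, mul_assoc, h2, mul_assoc, ← mul_assoc (x ^ k), hpow,
        one_mul, h2']; simp
    · rw [add_mul, pow_add, ← mul_assoc, h3, mul_assoc, ← mul_assoc (x ^ k), hpow,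
        one_mul, h3']; simp
  | neg c _ h =>
    obtain ⟨k, t, s, rfl, h2, h3⟩ := h
    exact ⟨k, -t, s, by simp, h2, by simp [h3]⟩
  | left_absorb a c _ h =>
    obtain ⟨k, t, s, rfl, h2, h3⟩ := h
    exact ⟨k, a * t, s, by simp [mul_assoc], h2, by simp [h3, mul_assoc]⟩
  | right_absorb a c _ h =>
    obtain ⟨k, t, s, rfl, h2, h3⟩ := h
    exact ⟨k, t, s * a, by simp [mul_assoc], by simp [h2, ← mul_assoc], h3⟩

theorem aux_xy {A : Type u} [Ring A] (hA : DirectlyInfinite Aᵐᵒᵖ A) :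
    ∃ x y : A, x * y = 1 ∧ y * x ≠ 1 := by
  obtain ⟨C, _, _, hC, ⟨φ⟩⟩ := hA
  have hφ : ∀ a : A, φ a = MulOpposite.op a • φ 1 := by
    intro a; rw [← map_smul]; simp
  have hψ : ∀ a : A, φ.symm (a, 0) = φ.symm (1, 0) * a := by
    intro a
    have := φ.symm.map_smul (MulOpposite.op a) ((1 : A), (0 : C))
    simpa using this
  refine ⟨(φ 1).1, φ.symm (1, 0), ?_, ?_⟩
  · have := hφ (φ.symm (1, 0))
    rw [LinearEquiv.apply_symm_apply] at this
    simpa using (congrArg Prod.fst this).symm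
  · intro h
    rw [← hψ, LinearEquiv.symm_apply_eq] at h
    have h2 : (φ 1).2 = 0 := (congrArg Prod.snd h).symm
    obtain ⟨c, hc⟩ := exists_ne (0 : C)
    apply hc
    have := hφ (φ.symm (0, c))
    rw [LinearEquiv.apply_symm_apply] at this
    simpa [h2] using congrArg Prod.snd this

theorem aux_step {B : Type v} [Ring B] [Nontrivial B] (R : ℕ → Subring B)
    (hmono : ∀ n, R n ≤ R (n + 1))
    (hE : ∀ n, ∃ E11 ∈ R (n + 1), ∃ E12 ∈ R (n + 1), ∃ E21 ∈ R (n + 1), ∃ E22 ∈ R (n + 1),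
      E11 + E22 = 1 ∧ E11 * E11 = E11 ∧ E12 * E21 = E11 ∧ E21 * E12 = E22 ∧ E11 * E12 = E12 ∧
      E21 * E11 = E21 ∧ E11 * E21 = 0 ∧ E12 * E11 = 0 ∧
      ∀ b ∈ R n, E11 * b = b * E11 ∧ E12 * b = b * E12 ∧ E21 * b = b * E21)
    {s1 s2 t1 t2 : B} (hs1 : ∀ n, s1 ∈ R n) (hs2 : ∀ n, s2 ∈ R n) (ht1 : ∀ n, t1 ∈ R n)
    (ht2 : ∀ n, t2 ∈ R n)
    (h11 : t1 * s1 = 1) (h12 : t1 * s2 = 0) (h21 : t2 * s1 = 0) (h22 : t2 * s2 = 1)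
    (b : B) (k : ℕ) : ∀ n, b ∈ R n → ∀ l : List (B × B), l.length = k →
      (∀ p ∈ l, p.1 ∈ R n ∧ p.2 ∈ R n) → (l.map (fun p => p.1 * b * p.2)).sum = 1 →
      ∃ x y, x * b * y = 1 := by
  induction k with
  | zero =>
    intro n _ l hl _ hsum
    rw [List.length_eq_zero_iff] at hl
    subst hl
    simp at hsum
  | succ k ih =>
    intro n hb l hl hmem hsum
    match l, hl with
    | [p], _ => exact ⟨p.1, p.2, by simpa using hsum⟩
    | p :: q :: l, hl =>
      obtain ⟨E11, m11, E12, m12, E21, m21, E22, m22, e1, e2, e3, e4, e5, e6, e7, e8, hc⟩ := hE n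
      have hp := hmem p (by simp)
      have hq := hmem q (by simp)
      set T := t1 * E11 + t2 * E21 with hT
      set S := E11 * s1 + E12 * s2 with hS
      have mT : T ∈ R (n + 1) := add_mem (mul_mem (ht1 _) m11) (mul_mem (ht2 _) m21)
      have mS : S ∈ R (n + 1) := add_mem (mul_mem m11 (hs1 _)) (mul_mem m12 (hs2 _))
      have hTS : T * E11 * S = 1 := by
        have a1 := hc s1 (hs1 n)
        have a2 := hc s2 (hs2 n)
        have : T * E11 = T := by rw [hT, add_mul, mul_assoc, mul_assoc, e2, e6]
        rw [this, hT, hS, a1.1, a2.2.1]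
        have c1 : t1 * E11 * (s1 * E11) = E11 := by
          rw [mul_assoc, ← mul_assoc E11, a1.1, mul_assoc, e2, ← mul_assoc, h11, one_mul]
        have c2 : t1 * E11 * (s2 * E12) = 0 := by
          rw [mul_assoc, ← mul_assoc E11, a2.1, mul_assoc, ← mul_assoc, h12, zero_mul]
        have c3 : t2 * E21 * (s1 * E11) = 0 := by
          rw [mul_assoc, ← mul_assoc E21, a1.2.2, mul_assoc, ← mul_assoc, h21, zero_mul]
        have c4 : t2 * E21 * (s2 * E12) = E22 := by
          rw [mul_assoc, ← mul_assoc E21, a2.2.2, mul_assoc, e4, ← mul_assoc, h22, one_mul]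
        rw [add_mul, mul_add, mul_add, c1, c2, c3, c4, add_zero, zero_add, e1]
      refine ih (n + 1) (hmono n hb)
        ((T * (E11 * p.1 + E12 * q.1), (p.2 * E11 + q.2 * E21) * S) ::
          l.map (fun r => (T * (E11 * r.1), r.2 * S))) ?_ ?_ ?_
      · simpa using hl
      · intro r hr
        rw [List.mem_cons, List.mem_map] at hr
        rcases hr with rfl | ⟨r, hr, rfl⟩
        · exact ⟨mul_mem mT (add_mem (mul_mem m11 (hmono n hp.1)) (mul_mem m12 (hmono n hq.1))),
            mul_mem (add_mem (mul_mem (hmono n hp.2) m11) (mul_mem (hmono n hq.2) m21)) mS⟩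
        · have := hmem r (by simp [hr])
          exact ⟨mul_mem mT (mul_mem m11 (hmono n this.1)), mul_mem (hmono n this.2) mS⟩
      · have key : (E11 * p.1 + E12 * q.1) * b * (p.2 * E11 + q.2 * E21)
            = E11 * (p.1 * b * p.2 + q.1 * b * q.2) := by
          have hpp : p.1 * b * p.2 ∈ R n := mul_mem (mul_mem hp.1 hb) hp.2
          have hpq : p.1 * b * q.2 ∈ R n := mul_mem (mul_mem hp.1 hb) hq.2
          have hqp : q.1 * b * p.2 ∈ R n := mul_mem (mul_mem hq.1 hb) hp.2
          have hqq : q.1 * b * q.2 ∈ R n := mul_mem (mul_mem hq.1 hb) hq.2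
          have i1 : E11 * (p.1 * b * p.2) * E11 = E11 * (p.1 * b * p.2) := by
            rw [mul_assoc, ← (hc _ hpp).1, ← mul_assoc, e2]
          have i2 : E11 * (p.1 * b * q.2) * E21 = 0 := by
            rw [mul_assoc, ← (hc _ hpq).2.2, ← mul_assoc, e7, zero_mul]
          have i3 : E12 * (q.1 * b * p.2) * E11 = 0 := by
            rw [mul_assoc, ← (hc _ hqp).1, ← mul_assoc, e8, zero_mul]
          have i4 : E12 * (q.1 * b * q.2) * E21 = E11 * (q.1 * b * q.2) := by
            rw [mul_assoc, ← (hc _ hqq).2.2, ← mul_assoc, e3]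
          calc _ = E11 * (p.1 * b * p.2) * E11 + E11 * (p.1 * b * q.2) * E21
                + E12 * (q.1 * b * p.2) * E11 + E12 * (q.1 * b * q.2) * E21 := by noncomm_ring
            _ = _ := by rw [i1, i2, i3, i4]; noncomm_ring
        rw [List.map_cons, List.sum_cons, List.map_map]
        have hl2 : (l.map ((fun p => p.1 * b * p.2) ∘
            (fun r : B × B => (T * (E11 * r.1), r.2 * S)))).sum
            = T * E11 * (l.map (fun p => p.1 * b * p.2)).sum * S := by
          rw [← List.sum_map_mul_left, ← List.sum_map_mul_right]
          congr 2; funext r; simp [mul_assoc]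
        rw [hl2]
        simp only [List.map_cons, List.sum_cons] at hsum
        calc _ = T * ((E11 * p.1 + E12 * q.1) * b * (p.2 * E11 + q.2 * E21)) * S
              + T * E11 * (l.map (fun p => p.1 * b * p.2)).sum * S := by
                simp only [mul_assoc]
          _ = T * E11 * (p.1 * b * p.2 + (q.1 * b * q.2 +
                (l.map (fun p => p.1 * b * p.2)).sum)) * S := by
              rw [key]; simp only [mul_assoc, mul_add, add_mul, add_assoc]
          _ = 1 := by rw [hsum, mul_one, hTS]

theorem aux_final {B : Type v} [Ring B] [Nontrivial B] (h : ∀ b : B, b ≠ 0 → ∃ x y, x * b * y = 1)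
    {x0 y0 : B} (hxy : x0 * y0 = 1) (hyx : y0 * x0 ≠ 1) : PurelyInfiniteSimple B := by
  constructor
  · apply IsSimpleRing.of_eq_bot_or_eq_top
    intro I
    rw [or_iff_not_imp_left, ← I.one_mem_iff]
    intro H
    obtain ⟨b, hb, hb0⟩ := SetLike.exists_of_lt (bot_lt_iff_ne_bot.mpr H : ⊥ < I)
    obtain ⟨x, y, e⟩ := h b hb0
    rw [← e]
    exact I.mul_mem_right _ _ (I.mul_mem_left _ _ hb)
  · intro I hI
    obtain ⟨b, hb, hb0⟩ := Submodule.exists_mem_ne_zero_of_ne_bot hI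
    obtain ⟨q, y, e⟩ := h b hb0
    obtain ⟨p, hp⟩ : ∃ p, p = b * y := ⟨_, rfl⟩
    have hqp : q * p = 1 := by rw [hp, ← mul_assoc, e]
    have hpI : p * q ∈ I := by
      have := I.smul_mem (MulOpposite.op (y * q)) hb
      rw [hp, mul_assoc]; simpa using this
    have hm : ∀ a c : B, p * a * q * (p * c * q) = p * (a * c) * q := by
      intro a c
      calc _ = p * a * (q * p) * c * q := by simp only [mul_assoc]
        _ = _ := by rw [hqp]; simp only [mul_assoc, one_mul, mul_one]
    have h1 : p * q = p * 1 * q := by simp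
    have hyy : y0 * x0 * (y0 * x0) = y0 * x0 := by
      rw [mul_assoc, ← mul_assoc x0, hxy, one_mul]
    refine ⟨p * q, hpI, ?_, p * (y0 * x0) * q, p * (1 - y0 * x0) * q, ?_, ?_, ?_, ?_, ?_, ?_,
      p * x0 * q, p * y0 * q, ?_, ?_, ?_, ?_⟩
    · rw [h1, IsIdempotentElem, hm, one_mul]
    · rw [IsIdempotentElem, hm, hyy]
    · rw [IsIdempotentElem, hm]; simp [mul_sub, sub_mul, hyy]
    · rw [hm]; simp [mul_sub, hyy]
    · rw [hm]; simp [sub_mul, hyy]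
    · simp [mul_sub, sub_mul]
    · intro h0
      apply hyx
      have : q * (p * (1 - y0 * x0) * q) * p = 1 - y0 * x0 := by
        calc _ = (q * p) * (1 - y0 * x0) * (q * p) := by simp only [mul_assoc]
          _ = _ := by rw [hqp]; simp
      rw [h0] at this
      simp at this
      exact (sub_eq_zero.1 this.symm).symm
    · rw [h1, hm, hm, one_mul, ← mul_assoc x0, hxy, one_mul]
    · rw [h1, hm, hm, mul_one, mul_assoc y0, hxy, mul_one]
    · rw [hm, hxy, mul_one]
    · rw [hm]

/-- If `A` is a simple ring which is directly infinite as a right module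
over itself, and `B` is a nonzero ring which is the direct limit (union) of the matrix
rings `M_{2^n}(A)` along the block-diagonal embeddings, then `B` is purely infinite
simple. -/
theorem stmt7 {A : Type u} [Ring A] [IsSimpleRing A]
    (hA : DirectlyInfinite Aᵐᵒᵖ A)
    (B : Type v) [Ring B] (hB : Nontrivial B)
    (f : ∀ n : ℕ, Matrix (Fin (2 ^ n)) (Fin (2 ^ n)) A →+* B)
    (hcomp : ∀ (n : ℕ) (a : Matrix (Fin (2 ^ n)) (Fin (2 ^ n)) A),
      f (n + 1) (matIota A n a) = f n a)
    (hunion : ∀ b : B, ∃ (n : ℕ) (a : Matrix (Fin (2 ^ n)) (Fin (2 ^ n)) A), f n a = b) :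
    PurelyInfiniteSimple B := by
  obtain ⟨x, y, hxy, hyx⟩ := aux_xy hA
  obtain ⟨s1, s2, t1, t2, h11, h12, h21, h22⟩ := aux_st hxy hyx
  let R : ℕ → Subring B := fun n => (f n).range
  have hmono : ∀ n, R n ≤ R (n + 1) := by
    rintro n _ ⟨a, rfl⟩
    exact ⟨_, hcomp n a⟩
  have h0 : ∀ n, R 0 ≤ R n := fun n => monotone_nat_of_le_succ hmono (Nat.zero_le n)
  let g : A →+* B := (f 0).comp (Matrix.scalar (Fin (2 ^ 0)))
  have hg : ∀ a n, g a ∈ R n := fun a n => h0 n ⟨_, rfl⟩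
  have hginj : Function.Injective g := RingHom.injective g
  have hz : ∀ b : B, b ≠ 0 → ∃ x y, x * b * y = 1 := by
    intro b hb
    obtain ⟨n, a, rfl⟩ := hunion b
    have ha : a ≠ 0 := by rintro rfl; simp at hb
    obtain ⟨l, hl⟩ := aux_list ha
    refine aux_step R hmono ?_ (hg s1) (hg s2) (hg t1) (hg t2)
      (by rw [← map_mul, h11, map_one]) (by rw [← map_mul, h12, map_zero])
      (by rw [← map_mul, h21, map_zero]) (by rw [← map_mul, h22, map_one])
      (f n a) l.length n ⟨a, rfl⟩ (l.map (fun p => (f n p.1, f n p.2))) (by simp) ?_ ?_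
    · intro m
      let e : Fin (2 ^ m) ⊕ Fin (2 ^ m) ≃ Fin (2 ^ (m + 1)) :=
        finSumFinEquiv.trans (finCongr (by rw [pow_succ, mul_two]))
      let F : Matrix (Fin (2 ^ m) ⊕ Fin (2 ^ m)) (Fin (2 ^ m) ⊕ Fin (2 ^ m)) A →+* B :=
        (f (m + 1)).comp (Matrix.reindexRingEquiv A e).toRingHom
      have hF : ∀ X, F X ∈ R (m + 1) := fun X => ⟨_, rfl⟩
      have hFa : ∀ a, f m a = F (Matrix.fromBlocks a 0 0 a) := fun a => (hcomp m a).symm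
      refine ⟨F (Matrix.fromBlocks 1 0 0 0), hF _, F (Matrix.fromBlocks 0 1 0 0), hF _,
        F (Matrix.fromBlocks 0 0 1 0), hF _, F (Matrix.fromBlocks 0 0 0 1), hF _,
        ?_, ?_, ?_, ?_, ?_, ?_, ?_, ?_, ?_⟩
      · rw [← map_add, Matrix.fromBlocks_add]; simp
      all_goals try (rw [← map_mul, Matrix.fromBlocks_multiply]; simp; done)
      rintro _ ⟨c, rfl⟩
      rw [hFa]
      simp only [← map_mul, Matrix.fromBlocks_multiply]
      simp
    · intro p hp
      obtain ⟨q, _, rfl⟩ := List.mem_map.1 hp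
      exact ⟨⟨_, rfl⟩, ⟨_, rfl⟩⟩
    · rw [List.map_map, ← map_one (f n), ← hl, map_list_sum, List.map_map]
      congr 2; funext p; simp
  refine aux_final hz (x0 := g x) (y0 := g y) (by rw [← map_mul, hxy, map_one]) ?_
  intro h
  apply hyx
  apply hginj
  rw [map_mul, h, map_one]
end

section
/- Let R be a purely infinite simple ring and let P and Q be nonzero finitely generated projective right R-modules which are stably isomorphic, i.e., P ⊕ Rⁿ ≅ Q ⊕ Rⁿ as right R-modules for some n ≥ 0. Then P ≅ Q. -/
universe u v w

theorem pis_span {R : Type*} [Ring R] (g z : R) (h : z ∈ TwoSidedIdeal.span {g}) :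
    ∃ (ι : Type) (_ : Fintype ι) (a b : ι → R), ∑ l, a l * g * b l = z := by
  rw [TwoSidedIdeal.mem_span_iff_mem_addSubgroup_closure] at h
  induction h using AddSubgroup.closure_induction with
  | mem x hx =>
    obtain ⟨_, ⟨a, -, _, rfl, rfl⟩, b, -, rfl⟩ := hx
    exact ⟨Unit, inferInstance, fun _ => a, fun _ => b, by simp⟩
  | zero => exact ⟨Empty, inferInstance, fun _ => 0, fun _ => 0, by simp⟩
  | add x y _ _ hx hy =>
    obtain ⟨ι, _, a, b, rfl⟩ := hx
    obtain ⟨κ, _, c, d, rfl⟩ := hy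
    exact ⟨ι ⊕ κ, inferInstance, Sum.elim a c, Sum.elim b d, by simp⟩
  | neg x _ hx =>
    obtain ⟨ι, _, a, b, rfl⟩ := hx
    exact ⟨ι, inferInstance, fun l => - a l, b, by simp⟩

theorem pis_core {R : Type*} [Ring R] (hs : IsSimpleRing R) {e : R} (he : IsInfiniteIdem e)
    (m : ℕ) : ∃ α β : Fin m → R, (∀ i, e * α i = α i) ∧
      ∀ i j, β i * α j = if i = j then 1 else 0 := by
  obtain ⟨hee, f, g, hf, hg, hfg, hgf, hefg, hg0, x, y, hx, hy, hxy, hyx⟩ := he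
  have heg : e * g = g := by rw [hefg, add_mul, hfg, hg.eq, zero_add]
  have hge : g * e = g := by rw [hefg, mul_add, hgf, hg.eq, zero_add]
  have hef : e * f = f := by rw [hefg, add_mul, hgf, hf.eq, add_zero]
  have hey : e * y = y := by rw [hy, ← mul_assoc, ← mul_assoc, hef]
  have hex : e * x = x := by rw [hx, ← mul_assoc, ← mul_assoc, hee.eq]
  have hgy : g * y = 0 := by rw [hy, ← mul_assoc, ← mul_assoc, hgf]; simp
  have hxg : x * g = 0 := by rw [hx, mul_assoc, hfg]; simp
  have hye : ∀ j, e * (y ^ j * g) = y ^ j * g := by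
    intro j
    cases j with
    | zero => simpa using heg
    | succ j => rw [pow_succ', mul_assoc, ← mul_assoc, hey]
  have hstep : ∀ i j, (g * x ^ (i+1)) * (y ^ (j+1) * g) = (g * x ^ i) * (y ^ j * g) := by
    intro i j
    calc _ = g * x ^ i * ((x * y) * (y ^ j * g)) := by
          rw [pow_succ, pow_succ']; simp only [mul_assoc]
      _ = _ := by rw [hxy, hye]
  have hvu : ∀ i j, (g * x ^ i) * (y ^ j * g) = if i = j then g else 0 := by
    intro i
    induction i with
    | zero =>
      intro j
      cases j with
      | zero => simp [hg.eq]
      | succ j =>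
        rw [if_neg (by omega), pow_zero, mul_one, pow_succ', ← mul_assoc, ← mul_assoc, hgy]
        simp
    | succ i ih =>
      intro j
      cases j with
      | zero =>
        rw [if_neg (by omega), pow_zero, one_mul, pow_succ, mul_assoc, mul_assoc, hxg]
        simp
      | succ j => rw [hstep, ih]; simp
  have h1 : (1 : R) ∈ TwoSidedIdeal.span {g} := by
    have : TwoSidedIdeal.span {g} = ⊤ := by
      rcases hs.simple.eq_bot_or_eq_top (TwoSidedIdeal.span {g}) with hb | ht
      · exfalso
        have : g ∈ TwoSidedIdeal.span {g} := TwoSidedIdeal.subset_span rfl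
        rw [hb] at this
        exact hg0 (by simpa using this)
      · exact ht
    rw [this]; trivial
  obtain ⟨ι, hι, a, b, h1⟩ := pis_span g 1 h1
  obtain ⟨k, ⟨E⟩⟩ := Finite.exists_equiv_fin (Fin m × ι)
  let c : Fin m → ι → ℕ := fun i l => (E (i, l)).val
  have hc : ∀ i j l l', c i l = c j l' ↔ i = j ∧ l = l' := by
    intro i j l l'
    simp [c, ← Fin.ext_iff]
  refine ⟨fun i => ∑ l, y ^ c i l * g * b l, fun i => ∑ l, a l * (g * x ^ c i l), ?_, ?_⟩
  · intro i
    rw [Finset.mul_sum]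
    refine Finset.sum_congr rfl fun l _ => ?_
    rw [← mul_assoc, hye]
  · classical
    intro i j
    rw [Finset.sum_mul_sum]
    have : ∀ l l', a l * (g * x ^ c i l) * (y ^ c j l' * g * b l') =
        if i = j ∧ l = l' then a l * g * b l' else 0 := by
      intro l l'
      calc _ = a l * ((g * x ^ c i l) * (y ^ c j l' * g)) * b l' := by simp only [mul_assoc]
        _ = _ := by
          rw [hvu]
          simp only [hc]
          split_ifs <;> simp
    simp only [this]
    by_cases hij : i = j
    · simp [hij, h1]
    · simp [hij]

theorem pis_split {S : Type*} [Ring S] {A B : Type*} [AddCommGroup A] [Module S A]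
    [AddCommGroup B] [Module S B] (i : A →ₗ[S] B) (s : B →ₗ[S] A) (h : ∀ a, s (i a) = a) :
    ∃ D : Submodule S B, Nonempty (B ≃ₗ[S] A × D) := by
  refine ⟨LinearMap.ker s, ⟨LinearEquiv.ofLinearMap
    (s.prod ((LinearMap.id - i ∘ₗ s).codRestrict _ (by intro b; simp [h])))
    (i.coprod (Submodule.subtype _)) ?_ ?_⟩⟩
  · ext a
    · simp [h]
    · simp [h]
    · simp
    · simp
  · ext b; simp

theorem pis_free {R : Type*} [Ring R] (h : PurelyInfiniteSimple R) {P : Type*}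
    [AddCommGroup P] [Module Rᵐᵒᵖ P] (φ : P →ₗ[Rᵐᵒᵖ] R) (hφ : φ ≠ 0) (m : ℕ) :
    ∃ D : Submodule Rᵐᵒᵖ P, Nonempty (P ≃ₗ[Rᵐᵒᵖ] (Fin m → R) × D) := by
  obtain ⟨e, ⟨p, hp⟩, he⟩ := h.2 (LinearMap.range φ) (by simpa [LinearMap.range_eq_bot] using hφ)
  obtain ⟨α, β, hα, hβ⟩ := pis_core h.1 he m
  refine pis_split
    { toFun := fun r => MulOpposite.op (∑ j, α j * r j) • p
      map_add' := by
        intro r r'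
        simp [mul_add, Finset.sum_add_distrib, add_smul]
      map_smul' := by
        intro c r
        rw [RingHom.id_apply, smul_smul]
        congr 1
        apply MulOpposite.unop_injective
        simp [Finset.sum_mul, mul_assoc] }
    { toFun := fun q i => β i * φ q
      map_add' := by intro q q'; ext i; simp [mul_add]
      map_smul' := by intro c q; ext i; simp [mul_assoc] } ?_
  intro r
  ext i
  simp only [LinearMap.coe_mk, AddHom.coe_mk, map_smul, hp,
    Pi.smul_apply, op_smul_eq_mul]
  rw [Finset.mul_sum]
  simp only [← mul_assoc]
  have : ∀ j, β i * e * α j * r j = if i = j then r j else 0 := by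
    intro j
    rw [mul_assoc (β i), hα, hβ]
    split_ifs <;> simp
  simp [this]

theorem pis_dual {R : Type*} [Ring R] (P : Type*) [AddCommGroup P] [Module Rᵐᵒᵖ P]
    (hproj : Module.Projective Rᵐᵒᵖ P) [Nontrivial P] : ∃ φ : P →ₗ[Rᵐᵒᵖ] R, φ ≠ 0 := by
  obtain ⟨s, hs⟩ := hproj.out
  obtain ⟨p, hp⟩ := exists_ne (0 : P)
  have h1 : s p ≠ 0 := by
    intro h0
    apply hp
    rw [← hs p, h0, map_zero]
  obtain ⟨q, hq⟩ := Finsupp.ne_iff.mp h1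
  refine ⟨{ toFun := fun x => MulOpposite.unop (s x q), map_add' := by simp, map_smul' := by simp }, ?_⟩
  intro h0
  apply hq
  have := LinearMap.congr_fun h0 p
  simpa using this

/-- Over a purely infinite simple ring, nonzero finitely generated
projective right modules which are stably isomorphic are isomorphic. -/
theorem stmt8 {R : Type u} [Ring R] (h : PurelyInfiniteSimple R)
    (P Q : Type v) [AddCommGroup P] [Module Rᵐᵒᵖ P] [AddCommGroup Q] [Module Rᵐᵒᵖ Q]
    (hPfin : Module.Finite Rᵐᵒᵖ P) (hPproj : Module.Projective Rᵐᵒᵖ P) (hP : Nontrivial P)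
    (hQfin : Module.Finite Rᵐᵒᵖ Q) (hQproj : Module.Projective Rᵐᵒᵖ Q) (hQ : Nontrivial Q)
    (n : ℕ) (hstab : Nonempty ((P × (Fin n → R)) ≃ₗ[Rᵐᵒᵖ] (Q × (Fin n → R)))) :
    Nonempty (P ≃ₗ[Rᵐᵒᵖ] Q) := by
  have := h.1
  have : Nontrivial R := inferInstance
  obtain ⟨D, ⟨E⟩⟩ := pis_free h (P := R) LinearMap.id
    (fun h0 => one_ne_zero (LinearMap.congr_fun h0 (1 : R))) 2
  let U := R × D
  have eR : R ≃ₗ[Rᵐᵒᵖ] R × U :=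
    (E.trans ((LinearEquiv.finTwoArrow Rᵐᵒᵖ R).prodCongr (LinearEquiv.refl _ _))).trans
      (LinearEquiv.prodAssoc Rᵐᵒᵖ R R D)
  have key : ∀ (M : Type v) [AddCommGroup M] [Module Rᵐᵒᵖ M],
      Module.Projective Rᵐᵒᵖ M → Nontrivial M → Nonempty (M ≃ₗ[Rᵐᵒᵖ] M × U) := by
    intro M _ _ h1 h2
    obtain ⟨φ, hφ⟩ := pis_dual M h1
    obtain ⟨D', ⟨F⟩⟩ := pis_free h φ hφ 1
    let F1 : M ≃ₗ[Rᵐᵒᵖ] D' × R := (F.trans ((LinearEquiv.funUnique (Fin 1) Rᵐᵒᵖ R).prodCongr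
      (LinearEquiv.refl _ _))).trans (LinearEquiv.prodComm _ _ _)
    exact ⟨((F1.trans ((LinearEquiv.refl _ _).prodCongr eR)).trans
      (LinearEquiv.prodAssoc Rᵐᵒᵖ D' R U).symm).trans
        (F1.symm.prodCongr (LinearEquiv.refl _ _))⟩
  obtain ⟨eP⟩ := key P hPproj hP
  obtain ⟨eQ⟩ := key Q hQproj hQ
  obtain ⟨T, ⟨eU⟩⟩ := pis_free h (P := U) (LinearMap.fst Rᵐᵒᵖ R D)
    (fun h0 => one_ne_zero (LinearMap.congr_fun h0 ((1 : R), (0 : D)))) n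
  obtain ⟨eS⟩ := hstab
  let GP := ((LinearEquiv.refl Rᵐᵒᵖ P).prodCongr eU).trans
    (LinearEquiv.prodAssoc Rᵐᵒᵖ P (Fin n → R) T).symm
  let GQ := ((LinearEquiv.refl Rᵐᵒᵖ Q).prodCongr eU).trans
    (LinearEquiv.prodAssoc Rᵐᵒᵖ Q (Fin n → R) T).symm
  exact ⟨(((eP.trans GP).trans (eS.prodCongr (LinearEquiv.refl _ _))).trans GQ.symm).trans eQ.symm⟩
end

section
/- Let R be a purely infinite simple ring. Then there exists a nonzero finitely generated projective right R-module E such that E ⊕ Q ≅ Q for every nonzero finitely generated projective right R-module Q, and such that for every nonzero finitely generated projective right R-module P there exists a nonzero finitely generated projective right R-module P' with P ⊕ P' ≅ E. (Thus the isomorphism classes of nonzero finitely generated projective right R-modules form an abelian group under direct sum, with identity element [E].) -/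
universe u v w

section Helpers

lemma aux_span {R : Type u} [Ring R] [IsSimpleRing R] (g : R) (hg : g ≠ 0) :
    ∃ (n : ℕ) (a b : Fin n → R), ∑ k, a k * g * b k = 1 := by
  have h1 : (1 : R) ∈ TwoSidedIdeal.span {g} :=
    IsSimpleRing.one_mem_of_ne_zero_mem _ hg (TwoSidedIdeal.subset_span rfl)
  rw [TwoSidedIdeal.mem_span_iff_mem_addSubgroup_closure] at h1
  refine AddSubgroup.closure_induction
    (p := fun r _ => ∃ (n : ℕ) (a b : Fin n → R), ∑ k, a k * g * b k = r) ?_ ?_ ?_ ?_ h1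
  · intro r hr
    obtain ⟨x, ⟨a, -, g', hg', rfl⟩, b, -, rfl⟩ := hr
    have : g' = g := hg'
    subst this
    exact ⟨1, fun _ => a, fun _ => b, by simp⟩
  · exact ⟨0, fun _ => 0, fun _ => 0, by simp⟩
  · rintro x y - - ⟨n, a, b, rfl⟩ ⟨m, c, d, rfl⟩
    exact ⟨n + m, Fin.append a c, Fin.append b d, by simp [Fin.sum_univ_add]⟩
  · rintro x - ⟨n, a, b, rfl⟩
    exact ⟨n, fun k => - a k, b, by simp⟩

lemma aux_pow {R : Type u} [Ring R] (e g x y : R) (hgg : g * g = g)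
    (heg : e * g = g) (hey : e * y = y) (hxy : x * y = e) (hxg : x * g = 0) (hgy : g * y = 0)
    (k l : ℕ) : g * x ^ k * (y ^ l * g) = if k = l then g else 0 := by
  induction k generalizing l with
  | zero =>
    cases l with
    | zero => simp [hgg]
    | succ l =>
      rw [pow_zero, mul_one, pow_succ', ← mul_assoc, ← mul_assoc, hgy]; simp
  | succ k ih =>
    cases l with
    | zero =>
      rw [pow_zero, one_mul, pow_succ, mul_assoc, mul_assoc, hxg]; simp
    | succ l =>
      have h2 : e * (y ^ l * g) = y ^ l * g := by
        cases l with
        | zero => simpa using heg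
        | succ l => rw [pow_succ', mul_assoc, ← mul_assoc, hey]
      have : g * x ^ (k + 1) * (y ^ (l + 1) * g) = g * x ^ k * (y ^ l * g) := by
        calc g * x ^ (k + 1) * (y ^ (l + 1) * g)
            = g * x ^ k * ((x * y) * (y ^ l * g)) := by
              rw [pow_succ, pow_succ']; simp only [mul_assoc]
          _ = _ := by rw [hxy, h2]
      rw [this, ih]
      simp

/-- ring-level statement -/
lemma aux_ring {R : Type u} [Ring R] [IsSimpleRing R] (e : R) (he : IsInfiniteIdem e) :
    ∃ p i g : R, e * i = i ∧ p * i = 1 ∧ e * g = g ∧ g ≠ 0 ∧ p * g = 0 := by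
  obtain ⟨hee, f, g, hf, hg, hfg, hgf, rfl, hg0, x, y, hx, hy, hxy, hyx⟩ := he
  have hf' : f * f = f := hf
  have hg' : g * g = g := hg
  have heg : (f + g) * g = g := by rw [add_mul, hfg, hg', zero_add]
  have hey : (f + g) * y = y := by
    rw [hy]; simp only [← mul_assoc]; rw [add_mul, hf', hgf, add_zero]
  have hxg : x * g = 0 := by rw [hx, mul_assoc, hfg, mul_zero]
  have hgy : g * y = 0 := by rw [hy]; simp only [← mul_assoc]; rw [hgf]; simp
  obtain ⟨n, a, b, hab⟩ := aux_span g hg0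
  have key := aux_pow (f + g) g x y hg' heg hey hxy hxg hgy
  refine ⟨∑ k, a k * (g * x ^ (k.val + 1)), ∑ k, y ^ (k.val + 1) * g * b k, g, ?_, ?_, heg, hg0, ?_⟩
  · rw [Finset.mul_sum]
    refine Finset.sum_congr rfl fun k _ => ?_
    rw [pow_succ']
    simp only [← mul_assoc]
    rw [hey]
  · rw [Finset.sum_mul_sum, ← hab]
    refine Finset.sum_congr rfl fun k _ => ?_
    have : ∀ l : Fin n, a k * (g * x ^ (k.val + 1)) * (y ^ (l.val + 1) * g * b l)
        = if k = l then a k * g * b l else 0 := by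
      intro l
      have h3 : a k * (g * x ^ (k.val + 1)) * (y ^ (l.val + 1) * g * b l)
        = a k * (g * x ^ (k.val + 1) * (y ^ (l.val + 1) * g)) * b l := by
        simp only [mul_assoc]
      rw [h3, key]
      by_cases hkl : k = l
      · simp [hkl]
      · have : k.val ≠ l.val := fun h => hkl (Fin.ext h)
        simp [hkl, this]
    simp [this]
  · rw [Finset.sum_mul]
    refine Finset.sum_eq_zero fun k _ => ?_
    rw [pow_succ, mul_assoc, mul_assoc, mul_assoc, hxg]; simp

/-- splitting -/
lemma aux_split {S : Type u} [Ring S] {A N : Type u} [AddCommGroup A] [Module S A]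
    [AddCommGroup N] [Module S N] (i : N →ₗ[S] A) (p : A →ₗ[S] N)
    (hpi : ∀ x, p (i x) = x) : Nonempty (A ≃ₗ[S] N × LinearMap.ker p) := by
  refine ⟨LinearEquiv.ofBijective
    (p.prod ((LinearMap.id - i ∘ₗ p).codRestrict (LinearMap.ker p) (fun a => by simp [hpi]))) ⟨?_, ?_⟩⟩
  · rw [injective_iff_map_eq_zero]
    intro a ha
    have h1 : p a = 0 := congrArg Prod.fst ha
    have h2 : a - i (p a) = 0 := congrArg (fun z => (z.2 : A)) ha
    simpa [h1] using h2
  · rintro ⟨n, ⟨a, ha⟩⟩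
    have ha' : p a = 0 := ha
    refine ⟨i n + a, Prod.ext ?_ (Subtype.ext ?_)⟩
    · simp [hpi, ha']
    · simp [hpi, ha']

/-- finitely generated projective nonzero modules -/
def Good (S : Type u) [Ring S] (A : Type u) [AddCommGroup A] [Module S A] : Prop :=
  Nontrivial A ∧ Module.Finite S A ∧ Module.Projective S A

lemma aux_snd {S : Type u} [Ring S] {A N C : Type u} [AddCommGroup A] [Module S A]
    [AddCommGroup N] [Module S N] [AddCommGroup C] [Module S C] (h : A ≃ₗ[S] N × C)
    [Module.Finite S A] [Module.Projective S A] :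
    Module.Finite S C ∧ Module.Projective S C := by
  constructor
  · exact Module.Finite.of_surjective (LinearMap.snd S N C ∘ₗ h.toLinearMap)
      (Prod.snd_surjective.comp h.surjective)
  · refine Module.Projective.of_split (h.symm.toLinearMap ∘ₗ LinearMap.inr S N C)
      (LinearMap.snd S N C ∘ₗ h.toLinearMap) ?_
    ext c; simp

lemma aux_step_s9 {R : Type u} [Ring R] (h : PurelyInfiniteSimple R) (A : Type u)
    [AddCommGroup A] [Module Rᵐᵒᵖ A] (hA : Good Rᵐᵒᵖ A) :
    ∃ (C : Type u) (_ : AddCommGroup C) (_ : Module Rᵐᵒᵖ C), Good Rᵐᵒᵖ C ∧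
      Nonempty (A ≃ₗ[Rᵐᵒᵖ] Rᵐᵒᵖ × C) := by
  obtain ⟨hs, hI⟩ := h
  obtain ⟨hA1, hA2, hA3⟩ := hA
  have hφ : ∃ (φ : A →ₗ[Rᵐᵒᵖ] Rᵐᵒᵖ) (a : A), φ a ≠ 0 := by
    obtain ⟨n, f, g, -, hg, -⟩ := Module.Finite.exists_comp_eq_id_of_projective Rᵐᵒᵖ A
    obtain ⟨a, ha⟩ := exists_ne (0 : A)
    have : g a ≠ 0 := fun h0 => ha (hg (by simpa using h0))
    obtain ⟨k, hk⟩ := Function.ne_iff.1 this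
    exact ⟨LinearMap.proj k ∘ₗ g, a, hk⟩
  obtain ⟨φ, a₁, ha₁⟩ := hφ
  let I : Submodule Rᵐᵒᵖ R :=
    { carrier := {r | ∃ a, φ a = MulOpposite.op r}
      add_mem' := by
        rintro r s ⟨a, ha⟩ ⟨b, hb⟩
        exact ⟨a + b, by simp [ha, hb]⟩
      zero_mem' := ⟨0, by simp⟩
      smul_mem' := by
        rintro c r ⟨a, ha⟩
        refine ⟨c • a, ?_⟩
        rw [map_smul, ha]
        rfl }
  have hI0 : I ≠ ⊥ := by
    intro hb
    have : MulOpposite.unop (φ a₁) ∈ I := ⟨a₁, rfl⟩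
    rw [hb, Submodule.mem_bot] at this
    exact ha₁ (MulOpposite.unop_injective this)
  obtain ⟨e, ⟨a, ha⟩, he⟩ := hI I hI0
  obtain ⟨p, i, g, hei, hpi, heg, hg0, hpg⟩ := aux_ring e he
  let ι : Rᵐᵒᵖ →ₗ[Rᵐᵒᵖ] A := LinearMap.toSpanSingleton Rᵐᵒᵖ A (MulOpposite.op i • a)
  let π : A →ₗ[Rᵐᵒᵖ] Rᵐᵒᵖ := LinearMap.toSpanSingleton Rᵐᵒᵖ Rᵐᵒᵖ (MulOpposite.op p) ∘ₗ φ
  have hπι : ∀ x, π (ι x) = x := by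
    intro x
    simp only [π, ι, LinearMap.comp_apply, LinearMap.toSpanSingleton_apply, map_smul, ha,
      smul_eq_mul, ← MulOpposite.op_mul, hei, mul_assoc, hpi, MulOpposite.op_one, mul_one]
  obtain ⟨E⟩ := aux_split ι π hπι
  refine ⟨LinearMap.ker π, inferInstance, inferInstance, ⟨?_, aux_snd E⟩, ⟨E⟩⟩
  refine ⟨⟨⟨MulOpposite.op g • a, ?_⟩, 0, ?_⟩⟩
  · simp only [π, LinearMap.mem_ker, LinearMap.comp_apply, LinearMap.toSpanSingleton_apply,
      map_smul, ha, smul_eq_mul, ← MulOpposite.op_mul]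
    rw [mul_assoc, heg, hpg, MulOpposite.op_zero]
  · intro h0
    have h1 : MulOpposite.op g • a = 0 := congrArg Subtype.val h0
    have h2 := congrArg φ h1
    rw [map_smul, ha, map_zero, smul_eq_mul, ← MulOpposite.op_mul, heg] at h2
    exact hg0 (MulOpposite.op_injective h2)

lemma aux_pi {R : Type u} [Ring R] (h : PurelyInfiniteSimple R) (n : ℕ) (A : Type u)
    [AddCommGroup A] [Module Rᵐᵒᵖ A] (hA : Good Rᵐᵒᵖ A) :
    ∃ (C : Type u) (_ : AddCommGroup C) (_ : Module Rᵐᵒᵖ C), Good Rᵐᵒᵖ C ∧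
      Nonempty (A ≃ₗ[Rᵐᵒᵖ] (Fin n → Rᵐᵒᵖ) × C) := by
  induction n with
  | zero => exact ⟨A, _, _, hA, ⟨LinearEquiv.uniqueProd.symm⟩⟩
  | succ n ih =>
    obtain ⟨C, _, _, hC, ⟨E⟩⟩ := ih
    obtain ⟨D, _, _, hD, ⟨F⟩⟩ := aux_step_s9 h C hC
    refine ⟨D, _, _, hD, ⟨E ≪≫ₗ (LinearEquiv.refl _ _).prodCongr F ≪≫ₗ
      (LinearEquiv.prodAssoc _ _ _ _).symm ≪≫ₗ
      (LinearEquiv.prodComm _ _ _ ≪≫ₗ Fin.consLinearEquiv Rᵐᵒᵖ (fun _ => Rᵐᵒᵖ)).prodCongr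
        (LinearEquiv.refl _ _)⟩⟩

lemma aux_main_s9 {R : Type u} [Ring R] (h : PurelyInfiniteSimple R) (A B : Type u)
    [AddCommGroup A] [Module Rᵐᵒᵖ A] [AddCommGroup B] [Module Rᵐᵒᵖ B]
    (hA : Good Rᵐᵒᵖ A) (hB : Good Rᵐᵒᵖ B) :
    ∃ (C : Type u) (_ : AddCommGroup C) (_ : Module Rᵐᵒᵖ C), Good Rᵐᵒᵖ C ∧
      Nonempty (A ≃ₗ[Rᵐᵒᵖ] B × C) := by
  obtain ⟨hB1, hB2, hB3⟩ := hB
  obtain ⟨n, f, g, -, -, hfg⟩ := Module.Finite.exists_comp_eq_id_of_projective Rᵐᵒᵖ B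
  obtain ⟨K⟩ := aux_split g f (fun x => LinearMap.congr_fun hfg x)
  obtain ⟨C, _, _, ⟨hC1, hC2, hC3⟩, ⟨E⟩⟩ := aux_pi h n A hA
  have F : A ≃ₗ[Rᵐᵒᵖ] B × (LinearMap.ker f × C) :=
    E ≪≫ₗ K.prodCongr (LinearEquiv.refl _ _) ≪≫ₗ LinearEquiv.prodAssoc _ _ _ _
  obtain ⟨hA1, hA2, hA3⟩ := hA
  exact ⟨LinearMap.ker f × C, _, _, ⟨inferInstance, aux_snd F⟩, ⟨F⟩⟩

end Helpers

/-- If `R` is purely infinite simple, then there is a nonzero finitely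
generated projective right `R`-module `E` which is a neutral element for `⊕` on nonzero
finitely generated projectives, and every nonzero finitely generated projective has an
inverse up to `E`; so the isomorphism classes of nonzero finitely generated projective
right `R`-modules form an abelian group under `⊕` with identity `[E]`. -/
theorem stmt9 {R : Type u} [Ring R] (h : PurelyInfiniteSimple R) :
    ∃ (E : Type u) (_ : AddCommGroup E) (_ : Module Rᵐᵒᵖ E),
      Nontrivial E ∧ Module.Finite Rᵐᵒᵖ E ∧ Module.Projective Rᵐᵒᵖ E ∧
      (∀ (Q : Type u) [AddCommGroup Q] [Module Rᵐᵒᵖ Q],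
        Nontrivial Q → Module.Finite Rᵐᵒᵖ Q → Module.Projective Rᵐᵒᵖ Q →
          Nonempty ((E × Q) ≃ₗ[Rᵐᵒᵖ] Q)) ∧
      (∀ (P : Type u) [AddCommGroup P] [Module Rᵐᵒᵖ P],
        Nontrivial P → Module.Finite Rᵐᵒᵖ P → Module.Projective Rᵐᵒᵖ P →
          ∃ (P' : Type u) (_ : AddCommGroup P') (_ : Module Rᵐᵒᵖ P'),
            Nontrivial P' ∧ Module.Finite Rᵐᵒᵖ P' ∧ Module.Projective Rᵐᵒᵖ P' ∧
            Nonempty ((P × P') ≃ₗ[Rᵐᵒᵖ] E)) := by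
  have hR : Good Rᵐᵒᵖ Rᵐᵒᵖ := by
    have := h.1
    exact ⟨inferInstance, inferInstance, inferInstance⟩
  obtain ⟨E, _, _, hE, ⟨F⟩⟩ := aux_main_s9 h Rᵐᵒᵖ Rᵐᵒᵖ hR hR
  refine ⟨E, _, _, hE.1, hE.2.1, hE.2.2, ?_, ?_⟩
  · intro Q _ _ h1 h2 h3
    obtain ⟨C, _, _, hC, ⟨G⟩⟩ := aux_main_s9 h Q Rᵐᵒᵖ ⟨h1, h2, h3⟩ hR
    exact ⟨(LinearEquiv.refl _ _).prodCongr G ≪≫ₗ (LinearEquiv.prodAssoc _ _ _ _).symm ≪≫ₗ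
      (LinearEquiv.prodComm _ _ _ ≪≫ₗ F.symm).prodCongr (LinearEquiv.refl _ _) ≪≫ₗ G.symm⟩
  · intro P _ _ h1 h2 h3
    obtain ⟨C, _, _, hC, ⟨G⟩⟩ := aux_main_s9 h E P hE ⟨h1, h2, h3⟩
    exact ⟨C, _, _, hC.1, hC.2.1, hC.2.2, ⟨G.symm⟩⟩
end

section
/- Let R be a ring, n ≥ 1 an integer, and for each i ∈ {1,…,n} let (τ_i, δ_i) be a right skew derivation on R. Then there exist a ring S, an injective ring homomorphism ι : R → S, and elements y_1, …, y_n ∈ S such that: (a) S is free as a right R-module (with R acting through ι) with basis the family of all products y_{i_1}·y_{i_2}⋯y_{i_t} indexed by the words (i_1,…,i_t) of the free monoid on {1,…,n} (the empty word giving the basis element 1); and (b) ι(r)·y_i = y_i·ι(τ_i(r)) + ι(δ_i(r)) for all i and all r ∈ R. -/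
universe u v

/-- A right skew derivation `(τ, δ)` on a ring `R`: `τ` is a ring endomorphism and `δ`
an additive map with `δ (r * s) = δ r * τ s + r * δ s`. -/
structure RightSkewDerivation (R : Type u) [Ring R] where
  τ : R →+* R
  δ : R →+ R
  skew : ∀ r s : R, δ (r * s) = δ r * τ s + r * δ s

namespace SkewAux

variable {R : Type u} [Ring R] {n : ℕ} (σ : Fin n → RightSkewDerivation R)

theorem emul (f g : AddMonoid.End (List (Fin n) →₀ R)) (x) : (f * g) x = f (g x) := rfl

theorem eadd (f g : AddMonoid.End (List (Fin n) →₀ R)) (x) : (f + g) x = f x + g x := rfl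

noncomputable def Y (i : Fin n) : AddMonoid.End (List (Fin n) →₀ R) :=
  Finsupp.liftAddHom (fun w => Finsupp.singleAddHom (i :: w))

noncomputable def act : List (Fin n) → R →+ R →+ (List (Fin n) →₀ R)
  | [] => (AddMonoidHom.compHom (Finsupp.singleAddHom [])).comp AddMonoidHom.mul
  | i :: w => (AddMonoidHom.compHom (Y (R := R) i)).comp ((act w).comp ((σ i).τ : R →+ R))
      + (act w).comp (σ i).δ

theorem Y_single (i : Fin n) (w : List (Fin n)) (s : R) :
    Y i (Finsupp.single w s) = Finsupp.single (i :: w) s := by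
  exact Finsupp.liftAddHom_apply_single _ _ _

theorem act_nil (r s : R) : act σ [] r s = Finsupp.single [] (r * s) := rfl

theorem act_cons (i : Fin n) (w : List (Fin n)) (r s : R) :
    act σ (i :: w) r s = Y i (act σ w ((σ i).τ r) s) + act σ w ((σ i).δ r) s := rfl

noncomputable def L0 (r : R) : AddMonoid.End (List (Fin n) →₀ R) :=
  Finsupp.liftAddHom (fun w => act σ w r)

theorem L0_single (r : R) (w : List (Fin n)) (s : R) :
    L0 σ r (Finsupp.single w s) = act σ w r s := by
  exact Finsupp.liftAddHom_apply_single _ _ _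

theorem L0_Y (r : R) (i : Fin n) (m : List (Fin n) →₀ R) :
    L0 σ r (Y i m) = Y i (L0 σ ((σ i).τ r) m) + L0 σ ((σ i).δ r) m := by
  induction m using Finsupp.induction_linear with
  | zero => simp
  | add f g hf hg => simp only [map_add, hf, hg]; abel
  | single w s => rw [Y_single, L0_single, L0_single, L0_single, act_cons]

theorem L0_add (r s : R) (m : List (Fin n) →₀ R) :
    L0 σ (r + s) m = L0 σ r m + L0 σ s m := by
  induction m using Finsupp.induction_linear with
  | zero => simp
  | add f g hf hg => simp only [map_add, hf, hg]; abel
  | single w t => simp [L0_single]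

theorem L0_mul (w : List (Fin n)) : ∀ (r s t : R),
    L0 σ (r * s) (Finsupp.single w t) = L0 σ r (L0 σ s (Finsupp.single w t)) := by
  induction w with
  | nil => intro r s t; rw [L0_single, L0_single, act_nil, act_nil, L0_single, act_nil, mul_assoc]
  | cons i w ih =>
    intro r s t
    rw [← Y_single, L0_Y, L0_Y, map_add, L0_Y, map_mul, (σ i).skew, L0_add, ih, ih, ih]
    abel

theorem delta_one (i : Fin n) : (σ i).δ 1 = 0 := by
  have := (σ i).skew 1 1
  simpa using this

theorem L0_one (w : List (Fin n)) : ∀ (t : R),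
    L0 σ 1 (Finsupp.single w t) = Finsupp.single w t := by
  induction w with
  | nil => intro t; simp [L0_single, act_nil]
  | cons i w ih =>
    intro t
    rw [← Y_single, L0_Y, map_one, ih, delta_one]
    simp [L0_single]

noncomputable def L : R →+* AddMonoid.End (List (Fin n) →₀ R) where
  toFun := L0 σ
  map_one' := by
    apply Finsupp.addHom_ext; intro w t; exact L0_one σ w t
  map_mul' r s := by
    apply Finsupp.addHom_ext; intro w t; exact L0_mul σ w r s t
  map_zero' := by
    apply Finsupp.addHom_ext; intro w t; exact (L0_single σ 0 w t).trans (by rw [map_zero]; rfl)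
  map_add' r s := by
    apply Finsupp.addHom_ext; intro w t; exact L0_add σ r s _

theorem L_Y (r : R) (i : Fin n) :
    L σ r * Y i = Y i * L σ ((σ i).τ r) + L σ ((σ i).δ r) := by
  ext1 m
  exact L0_Y σ r i m

noncomputable def Phi : (List (Fin n) →₀ R) →+ AddMonoid.End (List (Fin n) →₀ R) :=
  Finsupp.liftAddHom (fun w => (AddMonoidHom.mulLeft (w.map Y).prod).comp
    (L σ : R →+ AddMonoid.End (List (Fin n) →₀ R)))

theorem Phi_single (w : List (Fin n)) (r : R) :
    Phi σ (Finsupp.single w r) = (w.map Y).prod * L σ r := by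
  simp [Phi]

theorem Phi_apply (c : List (Fin n) →₀ R) :
    Phi σ c = c.sum fun w r => (w.map Y).prod * L σ r := rfl

theorem word_single (w v : List (Fin n)) (r : R) :
    (w.map Y).prod (Finsupp.single v r) = Finsupp.single (w ++ v) r := by
  induction w with
  | nil => simp
  | cons i w ih =>
    rw [List.map_cons, List.prod_cons, emul, ih, Y_single]; rfl

theorem Phi_eval (c : List (Fin n) →₀ R) : Phi σ c (Finsupp.single [] 1) = c := by
  induction c using Finsupp.induction_linear with
  | zero => simp
  | add f g hf hg => rw [map_add, eadd, hf, hg]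
  | single w s =>
    rw [Phi_single, emul]
    have : L σ s (Finsupp.single [] 1) = Finsupp.single [] s := by
      change L0 σ s _ = _
      rw [L0_single, act_nil, mul_one]
    rw [this, word_single, List.append_nil]

theorem Y_mul_mem (i : Fin n) (a : AddMonoid.End (List (Fin n) →₀ R)) (ha : a ∈ (Phi σ).range) : Y i * a ∈ (Phi σ).range := by
  obtain ⟨c, rfl⟩ := ha
  induction c using Finsupp.induction_linear with
  | zero => simp
  | add f g hf hg => rw [map_add, mul_add]; exact add_mem hf hg
  | single w s =>
    refine ⟨Finsupp.single (i :: w) s, ?_⟩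
    rw [Phi_single, Phi_single, List.map_cons, List.prod_cons, mul_assoc]

theorem word_mul_mem (w : List (Fin n)) (a : AddMonoid.End (List (Fin n) →₀ R)) (ha : a ∈ (Phi σ).range) :
    (w.map Y).prod * a ∈ (Phi σ).range := by
  induction w with
  | nil => simpa using ha
  | cons i w ih =>
    rw [List.map_cons, List.prod_cons, mul_assoc]; exact Y_mul_mem σ i _ ih

theorem L_mul_word_mem (w : List (Fin n)) : ∀ r s : R,
    L σ r * ((w.map Y).prod * L σ s) ∈ (Phi σ).range := by
  induction w with
  | nil =>
    intro r s
    refine ⟨Finsupp.single [] (r * s), ?_⟩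
    rw [Phi_single]; simp
  | cons i w ih =>
    intro r s
    rw [List.map_cons, List.prod_cons, mul_assoc, ← mul_assoc, L_Y, add_mul, mul_assoc]
    exact add_mem (Y_mul_mem σ i _ (ih _ _)) (ih _ _)

theorem L_mul_mem (r : R) (a : AddMonoid.End (List (Fin n) →₀ R)) (ha : a ∈ (Phi σ).range) : L σ r * a ∈ (Phi σ).range := by
  obtain ⟨c, rfl⟩ := ha
  induction c using Finsupp.induction_linear with
  | zero => simp
  | add f g hf hg => rw [map_add, mul_add]; exact add_mem hf hg
  | single w s => rw [Phi_single]; exact L_mul_word_mem σ w r s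

theorem mul_mem' (a b : AddMonoid.End (List (Fin n) →₀ R)) (ha : a ∈ (Phi σ).range) (hb : b ∈ (Phi σ).range) :
    a * b ∈ (Phi σ).range := by
  obtain ⟨c, rfl⟩ := ha
  induction c using Finsupp.induction_linear with
  | zero => simp
  | add f g hf hg => rw [map_add, add_mul]; exact add_mem hf hg
  | single w s =>
    rw [Phi_single, mul_assoc]
    exact word_mul_mem σ w _ (L_mul_mem σ s _ hb)

theorem L_mem (r : R) : L σ r ∈ (Phi σ).range :=
  ⟨Finsupp.single [] r, by rw [Phi_single]; simp⟩

theorem Y_mem (i : Fin n) : Y (R := R) i ∈ (Phi σ).range :=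
  ⟨Finsupp.single [i] 1, by rw [Phi_single]; simp⟩

noncomputable def T : Subring (AddMonoid.End (List (Fin n) →₀ R)) :=
  { (Phi σ).range with
    mul_mem' := fun {a b} ha hb => mul_mem' σ a b ha hb
    one_mem' := by
      have := L_mem σ 1
      rw [map_one] at this
      exact this }

noncomputable def io : R →+* T σ := (L σ).codRestrict (T σ) (L_mem σ)

noncomputable def yy (i : Fin n) : T σ := ⟨Y i, Y_mem σ i⟩

theorem sum_coe (c : List (Fin n) →₀ R) :
    ((c.sum fun w r => (w.map (yy σ)).prod * io σ r : T σ) :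
      AddMonoid.End (List (Fin n) →₀ R)) = Phi σ c := by
  rw [Phi_apply]
  change (T σ).subtype _ = _
  rw [map_finsuppSum]
  congr 1
  funext w r
  rw [map_mul, map_list_prod, List.map_map]
  rfl

end SkewAux

/-- Given right skew derivations `(τ_1, δ_1), …, (τ_n, δ_n)` on `R`,
there is a ring `S ⊇ R` (via an injective ring homomorphism `ι`) with elements
`y_1, …, y_n` such that `S` is free as a right `R`-module with basis the words in the
`y_i` indexed by the free monoid on `{1, …, n}` (freeness being expressed by unique
representation of every element of `S` as a finite right-`R`-linear combination of
these words), and `ι r * y_i = y_i * ι (τ_i r) + ι (δ_i r)` for all `i` and `r`. -/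
theorem stmt10 {R : Type u} [Ring R] (n : ℕ) (σ : Fin n → RightSkewDerivation R) :
    ∃ (S : Type u) (_ : Ring S) (ι : R →+* S) (y : Fin n → S),
      Function.Injective ι ∧
      (∀ s : S, ∃! c : FreeMonoid (Fin n) →₀ R,
        s = c.sum fun w r => (FreeMonoid.toList w |>.map y).prod * ι r) ∧
      (∀ (i : Fin n) (r : R), ι r * y i = y i * ι ((σ i).τ r) + ι ((σ i).δ r)) := by
  refine ⟨SkewAux.T σ, inferInstance, SkewAux.io σ, SkewAux.yy σ, ?_, ?_, ?_⟩
  · intro r s h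
    have h1 : SkewAux.L σ r = SkewAux.L σ s := congrArg Subtype.val h
    have h2 : SkewAux.Phi σ (Finsupp.single [] r) = SkewAux.Phi σ (Finsupp.single [] s) := by
      rw [SkewAux.Phi_single, SkewAux.Phi_single, h1]
    have h3 := congrArg (fun f => f (Finsupp.single [] 1)) h2
    simp only [SkewAux.Phi_eval] at h3
    exact Finsupp.single_injective _ h3
  · rintro ⟨s, c, rfl⟩
    refine ⟨c, Subtype.ext (SkewAux.sum_coe σ c).symm, ?_⟩
    intro d hd
    have h1 : SkewAux.Phi σ c = SkewAux.Phi σ d :=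
      (congrArg Subtype.val hd).trans (SkewAux.sum_coe σ d)
    have h3 := congrArg (fun f => f (Finsupp.single [] 1)) h1
    exact ((SkewAux.Phi_eval σ c).symm.trans (h3.trans (SkewAux.Phi_eval σ d))).symm
  · intro i r
    exact Subtype.ext (SkewAux.L_Y σ r i)
end

section
/- Let R be a ring with right skew derivations (τ_1,δ_1),…,(τ_n,δ_n). Let S be a ring with an injective ring homomorphism ι : R → S and elements y_1,…,y_n ∈ S such that S is free as a right R-module (with R acting through ι) with basis the products y_{i_1}⋯y_{i_t} taken over all words of the free monoid on {1,…,n}, and such that ι(r)·y_i = y_i·ι(τ_i(r)) + ι(δ_i(r)) for all i and all r ∈ R. Suppose φ : R → T is a ring homomorphism and t_1,…,t_n ∈ T are elements such that φ(r)·t_i = t_i·φ(τ_i(r)) + φ(δ_i(r)) for all i and all r ∈ R. Then there exists a unique ring homomorphism ψ : S → T such that ψ ∘ ι = φ and ψ(y_i) = t_i for all i. -/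
universe u v w

/-- Universal property of the skew polynomial ring
`R⟨Y; τ, δ⟩`: if `S` is a ring containing `R` via an injective ring homomorphism `ι`,
with elements `y_1, …, y_n` such that `S` is a free right `R`-module with basis the
words in the `y_i` (expressed by unique representation as right-`R`-linear combinations)
and `ι r * y_i = y_i * ι (τ_i r) + ι (δ_i r)`, then for any ring homomorphism
`φ : R → T` and elements `t_1, …, t_n` of `T` with
`φ r * t_i = t_i * φ (τ_i r) + φ (δ_i r)`, there is a unique ring homomorphism
`ψ : S → T` with `ψ ∘ ι = φ` and `ψ (y_i) = t_i`. -/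
theorem stmt11 {R : Type u} [Ring R] (n : ℕ) (σ : Fin n → RightSkewDerivation R)
    (S : Type v) [Ring S] (ι : R →+* S) (y : Fin n → S)
    (hinj : Function.Injective ι)
    (hfree : ∀ s : S, ∃! c : FreeMonoid (Fin n) →₀ R,
      s = c.sum fun w r => (FreeMonoid.toList w |>.map y).prod * ι r)
    (hrel : ∀ (i : Fin n) (r : R), ι r * y i = y i * ι ((σ i).τ r) + ι ((σ i).δ r))
    (T : Type w) [Ring T] (φ : R →+* T) (t : Fin n → T)
    (hT : ∀ (i : Fin n) (r : R), φ r * t i = t i * φ ((σ i).τ r) + φ ((σ i).δ r)) :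
    ∃! ψ : S →+* T, ψ.comp ι = φ ∧ ∀ i : Fin n, ψ (y i) = t i := by
  classical
  let ES : (FreeMonoid (Fin n) →₀ R) →+ S := Finsupp.liftAddHom fun w =>
    (AddMonoidHom.mulLeft ((FreeMonoid.toList w).map y).prod).comp ι.toAddMonoidHom
  let ET : (FreeMonoid (Fin n) →₀ R) →+ T := Finsupp.liftAddHom fun w =>
    (AddMonoidHom.mulLeft ((FreeMonoid.toList w).map t).prod).comp φ.toAddMonoidHom
  have hES : ∀ c, ES c = c.sum fun w r => (FreeMonoid.toList w |>.map y).prod * ι r :=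
    fun c => rfl
  have hES1 : ∀ w r, ES (Finsupp.single w r) = ((FreeMonoid.toList w).map y).prod * ι r := by
    intro w r
    simp [ES]
  have hET1 : ∀ w r, ET (Finsupp.single w r) = ((FreeMonoid.toList w).map t).prod * φ r := by
    intro w r
    simp [ET]
  have hbij : Function.Bijective ES := by
    constructor
    · intro a b hab
      exact (hfree (ES a)).unique (hES a) (hab.trans (hES b))
    · intro s
      obtain ⟨c, hc, -⟩ := hfree s
      exact ⟨c, ((hES c).trans hc.symm)⟩
  let e := AddEquiv.ofBijective ES hbij
  let f : S →+ T := ET.comp e.symm.toAddMonoidHom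
  have hf : ∀ c, f (ES c) = ET c := by
    intro c
    change ET (e.symm (e c)) = ET c
    rw [e.symm_apply_apply]
  have hfw : ∀ (l : List (Fin n)) r, f ((l.map y).prod * ι r) = (l.map t).prod * φ r := by
    intro l r
    have h := hf (Finsupp.single (FreeMonoid.ofList l) r)
    rw [hES1, hET1] at h
    exact h
  have ind : ∀ (P : S → Prop), P 0 → (∀ a b, P a → P b → P (a + b)) →
      (∀ (l : List (Fin n)) r, P ((l.map y).prod * ι r)) → ∀ s, P s := by
    intro P h0 hadd hw s
    obtain ⟨c, rfl⟩ := hbij.2 s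
    induction c using Finsupp.induction_linear with
    | zero => rw [map_zero]; exact h0
    | add a b ha hb => rw [map_add]; exact hadd _ _ ha hb
    | single w r => rw [hES1]; exact hw _ r
  have hfι : ∀ r, f (ι r) = φ r := by
    intro r
    simpa using hfw [] r
  have hfy : ∀ i, f (y i) = t i := by
    intro i
    simpa using hfw [i] 1
  have mulι : ∀ r a, f (a * ι r) = f a * f (ι r) := by
    intro r
    apply ind
    · simp
    · intro a b ha hb
      rw [add_mul, map_add, map_add, ha, hb, add_mul]
    · intro l s
      rw [mul_assoc, ← map_mul, hfw, hfw, hfι, map_mul, mul_assoc]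
  have muly : ∀ i a, f (a * y i) = f a * f (y i) := by
    intro i
    apply ind
    · simp
    · intro a b ha hb
      rw [add_mul, map_add, map_add, ha, hb, add_mul]
    · intro l s
      have h1 := hfw (l ++ [i]) ((σ i).τ s)
      simp only [List.map_append, List.prod_append, List.map_cons, List.map_nil,
        List.prod_singleton] at h1
      rw [mul_assoc, hrel, mul_add, map_add, ← mul_assoc, h1, hfw, hfw, hfy, mul_assoc, mul_assoc,
        hT, mul_add]
  have mull : ∀ (l : List (Fin n)) a, f (a * (l.map y).prod) = f a * (l.map t).prod := by
    intro l
    induction l with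
    | nil => simp
    | cons i l ih =>
      intro a
      simp only [List.map_cons, List.prod_cons]
      rw [← mul_assoc, ih, muly, hfy, mul_assoc]
  have hmul : ∀ b a, f (a * b) = f a * f b := by
    apply ind
    · simp
    · intro b c hb hc a
      rw [mul_add, map_add, map_add, hb, hc, mul_add]
    · intro l r a
      rw [← mul_assoc, mulι, mull, hfw, hfι, mul_assoc]
  have hone : f 1 = 1 := by
    simpa using hfι 1
  refine ⟨{ f with map_one' := hone, map_mul' := fun a b => hmul b a },
    ⟨RingHom.ext hfι, hfy⟩, ?_⟩
  rintro ψ ⟨h1, h2⟩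
  apply RingHom.ext
  change ∀ s, ψ s = f s
  apply ind
  · simp
  · intro a b ha hb
    rw [map_add, map_add, ha, hb]
  · intro l r
    have h3 : ψ (ι r) = φ r := by rw [← h1]; rfl
    rw [hfw, map_mul, h3, map_list_prod, List.map_map]
    congr 3
    funext i
    exact h2 i
end

section
/- Let k be a field and n ≥ 1 an integer, and let U be the k-algebra presented by generators x_1,…,x_n, y_1,…,y_n and relations x_i·y_j = δ_{ij}·1 for all i, j (the quotient of the free k-algebra k⟨x_1,…,x_n,y_1,…,y_n⟩ by these relations). Then the family of 'monowords' y_{i_1}⋯y_{i_s}·x_{j_1}⋯x_{j_t}, indexed by the pairs ((i_1,…,i_s),(j_1,…,j_t)) of words over {1,…,n} (empty words allowed, an empty product being 1), forms a basis of U as a k-vector space. -/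
universe u

open scoped BigOperators

/-- The defining relations of the algebra `U = U_{1,n}`: on the free algebra on
generators `x_1, …, x_n` (encoded as `Sum.inl i`) and `y_1, …, y_n` (encoded as
`Sum.inr j`), the relations `x_i * y_j = δ_{ij} · 1`. -/
inductive URel (k : Type u) [Field k] (n : ℕ) :
    FreeAlgebra k (Fin n ⊕ Fin n) → FreeAlgebra k (Fin n ⊕ Fin n) → Prop
  | xy (i j : Fin n) : URel k n
      (FreeAlgebra.ι k (Sum.inl i) * FreeAlgebra.ι k (Sum.inr j))
      (if i = j then 1 else 0)

/-- The `k`-algebra presented by generators `x_1, …, x_n, y_1, …, y_n` and relations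
`x_i y_j = δ_{ij}`. -/
abbrev UAlg (k : Type u) [Field k] (n : ℕ) := RingQuot (URel k n)

/-- The monoword `y_{i_1} ⋯ y_{i_s} · x_{j_1} ⋯ x_{j_t}` in `U` associated to the pair
of words `((i_1,…,i_s), (j_1,…,j_t))`. -/
noncomputable def monoword (k : Type u) [Field k] (n : ℕ)
    (p : List (Fin n) × List (Fin n)) : UAlg k n :=
  (p.1.map fun i => RingQuot.mkAlgHom k (URel k n) (FreeAlgebra.ι k (Sum.inr i))).prod *
  (p.2.map fun j => RingQuot.mkAlgHom k (URel k n) (FreeAlgebra.ι k (Sum.inl j))).prod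

/-- action of `x_i` on normal forms -/
noncomputable def actX (k : Type u) [Field k] (n : ℕ) (i : Fin n) :
    List (Fin n) × List (Fin n) → ((List (Fin n) × List (Fin n)) →₀ k)
  | ([], J) => Finsupp.single ([], i :: J) 1
  | (j :: I, J) => if i = j then Finsupp.single (I, J) 1 else 0

/-- action of the generators -/
noncomputable def actGen (k : Type u) [Field k] (n : ℕ) :
    Fin n ⊕ Fin n → Module.End k ((List (Fin n) × List (Fin n)) →₀ k)
  | Sum.inl i => Finsupp.linearCombination k (actX k n i)
  | Sum.inr i => Finsupp.linearCombination k
      (fun p => Finsupp.single (i :: p.1, p.2) (1 : k))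

/-- the representation of `U` on normal forms -/
noncomputable def actU (k : Type u) [Field k] (n : ℕ) :
    UAlg k n →ₐ[k] Module.End k ((List (Fin n) × List (Fin n)) →₀ k) :=
  RingQuot.liftAlgHom k ⟨FreeAlgebra.lift k (actGen k n), by
    intro a b h
    cases h with
    | xy i j =>
      refine Finsupp.lhom_ext' fun p => LinearMap.ext_ring ?_
      split_ifs with h <;> simp [actGen, actX, h]⟩

theorem actU_gen (k : Type u) [Field k] (n : ℕ) (s : Fin n ⊕ Fin n) :
    actU k n (RingQuot.mkAlgHom k (URel k n) (FreeAlgebra.ι k s)) = actGen k n s := by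
  simp [actU]

theorem actU_x (k : Type u) [Field k] (n : ℕ) (J : List (Fin n)) :
    actU k n (J.map fun j => RingQuot.mkAlgHom k (URel k n)
      (FreeAlgebra.ι k (Sum.inl j))).prod (Finsupp.single ([], []) 1)
      = Finsupp.single ([], J) 1 := by
  induction J with
  | nil => simp
  | cons j J ih =>
    rw [List.map_cons, List.prod_cons, map_mul, Module.End.mul_apply, ih, actU_gen]
    simp [actGen, actX]

theorem actU_y (k : Type u) [Field k] (n : ℕ) (I J : List (Fin n)) :
    actU k n (I.map fun j => RingQuot.mkAlgHom k (URel k n)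
      (FreeAlgebra.ι k (Sum.inr j))).prod (Finsupp.single ([], J) 1)
      = Finsupp.single (I, J) 1 := by
  induction I with
  | nil => simp
  | cons j I ih =>
    rw [List.map_cons, List.prod_cons, map_mul, Module.End.mul_apply, ih, actU_gen]
    simp [actGen]

theorem gen_mul_monoword (k : Type u) [Field k] (n : ℕ) (s : Fin n ⊕ Fin n)
    (p : List (Fin n) × List (Fin n)) :
    RingQuot.mkAlgHom k (URel k n) (FreeAlgebra.ι k s) * monoword k n p ∈
      Submodule.span k (Set.range (monoword k n)) := by
  obtain ⟨I, J⟩ := p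
  rcases s with i | i
  · cases I with
    | nil =>
      refine Submodule.subset_span ⟨([], i :: J), ?_⟩
      simp [monoword]
    | cons j I =>
      have h := RingQuot.mkAlgHom_rel k (URel.xy (k := k) i j)
      rw [map_mul] at h
      have e : RingQuot.mkAlgHom k (URel k n) (FreeAlgebra.ι k (Sum.inl i)) *
          monoword k n (j :: I, J) =
          RingQuot.mkAlgHom k (URel k n) (if i = j then 1 else 0) * monoword k n (I, J) := by
        rw [← h]
        simp only [monoword, List.map_cons, List.prod_cons, mul_assoc]
      rw [e]
      split_ifs
      · rw [map_one, one_mul]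
        exact Submodule.subset_span ⟨_, rfl⟩
      · rw [map_zero, zero_mul]
        exact Submodule.zero_mem _
  · refine Submodule.subset_span ⟨(i :: I, J), ?_⟩
    simp [monoword, mul_assoc]

theorem mul_mem_monospan (k : Type u) [Field k] (n : ℕ)
    (a : FreeAlgebra k (Fin n ⊕ Fin n)) :
    ∀ m ∈ Submodule.span k (Set.range (monoword k n)),
      RingQuot.mkAlgHom k (URel k n) a * m ∈
        Submodule.span k (Set.range (monoword k n)) := by
  induction a using FreeAlgebra.induction with
  | grade0 r =>
    intro m hm
    rw [AlgHom.commutes, ← Algebra.smul_def]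
    exact Submodule.smul_mem _ _ hm
  | grade1 s =>
    intro m hm
    induction hm using Submodule.span_induction with
    | mem x hx =>
      obtain ⟨p, rfl⟩ := hx
      exact gen_mul_monoword k n s p
    | zero => rw [mul_zero]; exact Submodule.zero_mem _
    | add x y _ _ hx hy => rw [mul_add]; exact Submodule.add_mem _ hx hy
    | smul r x _ hx => rw [mul_smul_comm]; exact Submodule.smul_mem _ _ hx
  | mul a b ha hb =>
    intro m hm
    rw [map_mul, mul_assoc]
    exact ha _ (hb _ hm)
  | add a b ha hb =>
    intro m hm
    rw [map_add, add_mul]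
    exact Submodule.add_mem _ (ha _ hm) (hb _ hm)

/-- The monowords `y_I x_J` form a `k`-vector space basis of the
algebra `U` presented by generators `x_1, …, x_n, y_1, …, y_n` and relations
`x_i y_j = δ_{ij} · 1`. -/
theorem stmt12 (k : Type u) [Field k] (n : ℕ) (hn : 1 ≤ n) :
    LinearIndependent k (monoword k n) ∧
    Submodule.span k (Set.range (monoword k n)) = ⊤ := by
  constructor
  · let f : UAlg k n →ₗ[k] ((List (Fin n) × List (Fin n)) →₀ k) :=
      (LinearMap.applyₗ (Finsupp.single ([], []) (1 : k))).comp (actU k n).toLinearMap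
    refine LinearIndependent.of_comp f ?_
    have e : f ∘ monoword k n = fun p => Finsupp.single p (1 : k) := by
      funext p
      change actU k n (monoword k n p) (Finsupp.single ([], []) 1) = _
      rw [monoword, map_mul, Module.End.mul_apply, actU_x, actU_y]
    rw [e]
    exact Finsupp.linearIndependent_single_one k _
  · rw [eq_top_iff]
    rintro u -
    obtain ⟨a, rfl⟩ := RingQuot.mkAlgHom_surjective k (URel k n) u
    have h := mul_mem_monospan k n a (monoword k n ([], []))
      (Submodule.subset_span ⟨_, rfl⟩)
    simpa [monoword] using h
end
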